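/- arXiv:2406.06436 — 13 statements merged into one kernel-verified Lean document; each statement's English description precedes it below -/
import Mathlib

section
/- Let s : ℕ → ℕ be a C-recursive sequence of degree d ≥ 2 with integer coefficients α₁, …, α_d (α_d ≠ 0), let B(X) = α_d + α_{d−1}X + ⋯ + α₁X^{d−1} + X^d ∈ ℤ[X] and S_k(X) = s(k) + s(k−1)X + ⋯ + s(0)X^k, and for every natural number k ≥ d−1 write C_k(X) = c₀(k) + c₁(k)X + ⋯ + c_{d−1}(k)X^{d−1} for the polynomial C_k(X) = (B(X)·S_k(X)) mod X^d (the remainder of B·S_k upon division by X^d). Then there exists a natural number b such that |c_i(k)| < b^{k/3} for all i ∈ {0, 1, …, d−1} and all k ≥ d−1. -/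
open Polynomial

theorem exists_pow_bound_of_recurrence (s : ℕ → ℕ) (d : ℕ) (α : ℕ → ℤ)
    (hrec : ∀ n : ℕ,
      (s (n + d) : ℤ) + ∑ i ∈ Finset.range d, α (i + 1) * (s (n + (d - 1 - i)) : ℤ) = 0) :
    ∃ A : ℤ, 1 ≤ A ∧ ∀ n, (s n : ℤ) ≤ A ^ (n + 1) := by
  set P : ℤ := ∑ i ∈ Finset.range d, |α (i + 1)| with hP
  set Q : ℤ := ∑ i ∈ Finset.range d, (s i : ℤ) with hQ
  have hP0 : 0 ≤ P := Finset.sum_nonneg fun _ _ => abs_nonneg _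
  have hQ0 : 0 ≤ Q := Finset.sum_nonneg fun _ _ => by positivity
  have hA : 1 ≤ 1 + P + Q := by linarith
  refine ⟨1 + P + Q, hA, fun n => ?_⟩
  induction n using Nat.strong_induction_on with
  | _ n ih =>
    rcases lt_or_ge n d with hn | hn
    · have h1 : (s n : ℤ) ≤ Q :=
        Finset.single_le_sum (f := fun i => (s i : ℤ)) (fun _ _ => by positivity)
          (Finset.mem_range.2 hn)
      exact (by linarith : (s n : ℤ) ≤ 1 + P + Q).trans (le_self_pow₀ hA n.succ_ne_zero)
    · obtain ⟨m, rfl⟩ := Nat.exists_eq_add_of_le' hn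
      calc (s (m + d) : ℤ)
          = ∑ i ∈ Finset.range d, -(α (i + 1) * (s (m + (d - 1 - i)) : ℤ)) := by
            rw [Finset.sum_neg_distrib]; linarith [hrec m]
        _ ≤ ∑ i ∈ Finset.range d, |α (i + 1)| * (1 + P + Q) ^ (m + d) := by
            refine Finset.sum_le_sum fun i hi => ?_
            have hi' := Finset.mem_range.1 hi
            refine (neg_le_abs _).trans ?_
            rw [abs_mul, Nat.abs_cast]
            refine mul_le_mul_of_nonneg_left ?_ (abs_nonneg _)
            exact (ih _ (by omega)).trans (pow_le_pow_right₀ hA (by omega))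
        _ = P * (1 + P + Q) ^ (m + d) := by rw [← Finset.sum_mul]
        _ ≤ (1 + P + Q) ^ (m + d + 1) := by
            rw [pow_succ' _ (m + d)]
            exact mul_le_mul_of_nonneg_right (by linarith) (by positivity)

theorem Polynomial.coeff_modByMonic_X_pow {R : Type*} [CommRing R] (p : R[X]) {d i : ℕ}
    (hi : i < d) : (p %ₘ X ^ d).coeff i = p.coeff i := by
  conv_rhs => rw [← modByMonic_add_div p (X ^ d)]
  rw [coeff_add, coeff_X_pow_mul', if_neg (by omega), add_zero]

theorem Polynomial.abs_coeff_mul_le (p q : ℤ[X]) {d i : ℕ} (hi : i < d) {M : ℤ}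
    (hq : ∀ j, |q.coeff j| ≤ M) :
    |(p * q).coeff i| ≤ (∑ a ∈ Finset.range d, |p.coeff a|) * M := by
  have hM : 0 ≤ M := (abs_nonneg _).trans (hq 0)
  rw [coeff_mul, Finset.Nat.sum_antidiagonal_eq_sum_range_succ
    (fun a b => p.coeff a * q.coeff b) i, Finset.sum_mul]
  calc |∑ a ∈ Finset.range (i + 1), p.coeff a * q.coeff (i - a)|
      ≤ ∑ a ∈ Finset.range (i + 1), |p.coeff a * q.coeff (i - a)| :=
        Finset.abs_sum_le_sum_abs _ _
    _ ≤ ∑ a ∈ Finset.range (i + 1), |p.coeff a| * M :=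
        Finset.sum_le_sum fun a _ => by
          rw [abs_mul]; exact mul_le_mul_of_nonneg_left (hq _) (abs_nonneg _)
    _ ≤ ∑ a ∈ Finset.range d, |p.coeff a| * M :=
        Finset.sum_le_sum_of_subset_of_nonneg
          (Finset.range_subset_range.2 hi) fun _ _ _ => by positivity

/-- For a C-recursive sequence `s : ℕ → ℕ` of degree `d ≥ 2` with integer coefficients,
with `B(X) = α_d + ⋯ + α₁ X^(d-1) + X^d` and `S_k(X) = s k + s (k-1) X + ⋯ + s 0 X^k`,
the coefficients `c_i(k)` of `C_k(X) = (B · S_k) mod X^d` satisfy: there is a natural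
number `b` with `|c_i(k)| < b ^ (k / 3)` for all `i < d` and all `k ≥ d - 1`. -/
theorem stmt_4 (s : ℕ → ℕ) (d : ℕ) (hd : 2 ≤ d) (α : ℕ → ℤ) (hαd : α d ≠ 0)
    (hrec : ∀ n : ℕ,
      (s (n + d) : ℤ) + ∑ i ∈ Finset.range d, α (i + 1) * (s (n + (d - 1 - i)) : ℤ) = 0)
    (B : ℤ[X]) (hB : B = X ^ d + ∑ j ∈ Finset.range d, Polynomial.C (α (d - j)) * X ^ j)
    (S : ℕ → ℤ[X])
    (hS : ∀ k : ℕ, S k = ∑ j ∈ Finset.range (k + 1), Polynomial.C ((s (k - j) : ℤ)) * X ^ j) :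
    ∃ b : ℕ, ∀ k : ℕ, d - 1 ≤ k → ∀ i : ℕ, i < d →
      |((((B * S k) %ₘ X ^ d).coeff i : ℤ) : ℝ)| < (b : ℝ) ^ ((k : ℝ) / 3) := by
  obtain ⟨A, hA, hs⟩ := exists_pow_bound_of_recurrence s d α hrec
  set M : ℤ := ∑ a ∈ Finset.range d, |B.coeff a| with hM
  have hM0 : 0 ≤ M := Finset.sum_nonneg fun _ _ => abs_nonneg _
  obtain ⟨T, hT⟩ : ∃ T : ℕ, (T : ℤ) = M + A := ⟨(M + A).toNat, by omega⟩
  refine ⟨(T + 1) ^ 9, fun k hk i hi => ?_⟩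
  have hSk : ∀ j, |(S k).coeff j| ≤ A ^ (k + 1) := by
    intro j
    have hcoeff : (S k).coeff j = if j < k + 1 then (s (k - j) : ℤ) else 0 := by
      rw [hS, finsetSum_coeff]
      simp only [coeff_C_mul, coeff_X_pow, mul_ite, mul_one, mul_zero, Finset.sum_ite_eq,
        Finset.mem_range]
    rw [hcoeff]
    split_ifs
    · rw [Nat.abs_cast]
      exact (hs _).trans (pow_le_pow_right₀ hA (by omega))
    · rw [abs_zero]; positivity
  have hbound : |((B * S k) %ₘ X ^ d).coeff i| < ((T : ℤ) + 1) ^ (3 * k) := by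
    rw [coeff_modByMonic_X_pow _ hi]
    calc |(B * S k).coeff i| ≤ M * A ^ (k + 1) := abs_coeff_mul_le B (S k) hi hSk
      _ ≤ T * (T : ℤ) ^ (k + 1) := by gcongr <;> omega
      _ = (T : ℤ) ^ (k + 2) := by ring
      _ < ((T : ℤ) + 1) ^ (k + 2) := pow_lt_pow_left₀ (by omega) (by omega) (by omega)
      _ ≤ ((T : ℤ) + 1) ^ (3 * k) := pow_le_pow_right₀ (by omega) (by omega)
  have hpow : (((T + 1) ^ 9 : ℕ) : ℝ) ^ ((k : ℝ) / 3) = ((T : ℝ) + 1) ^ (3 * k) := by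
    push_cast
    rw [← Real.rpow_natCast, ← Real.rpow_natCast, ← Real.rpow_mul (by positivity)]
    congr 1
    push_cast
    ring
  rw [hpow]
  exact_mod_cast hbound
end

section
/- Let s : ℕ → ℕ be a C-recursive sequence of degree d ≥ 2 with integer coefficients α₁, …, α_d (α_d ≠ 0). Let B(X) = α_d + α_{d−1}X + ⋯ + α₁X^{d−1} + X^d ∈ ℤ[X], let S_{d−1}(X) = s(d−1) + s(d−2)X + ⋯ + s(0)X^{d−1}, and let A(X) ∈ ℤ[X] be the exact polynomial quotient of B(X)·S_{d−1}(X) by X^d, i.e. the unique polynomial with B(X)·S_{d−1}(X) = (B(X)·S_{d−1}(X) mod X^d) + X^d·A(X). Then there exist natural numbers b₀ and n₀ such that for every natural number b ≥ b₀ and every integer n ≥ n₀: s(n) = ⌊((b^{n(d−2)+⌈n/2⌉} + b^{n²}·A(b^n)) mod B(b^n)) / b^{n(d−1)}⌋. -/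
open Polynomial

/-- The coefficient of `X ^ (d - 1 - j)` in the remainder of `X ^ n * A` modulo `B`. -/
def remainderCoeff (s : ℕ → ℕ) (α : ℕ → ℤ) (n j : ℕ) : ℤ :=
  (s (n + j) : ℤ) + ∑ i ∈ Finset.range j, α (i + 1) * (s (n + (j - 1 - i)) : ℤ)

/-- The remainder of `X ^ n * A` modulo `B`. -/
noncomputable def remainderPoly (s : ℕ → ℕ) (α : ℕ → ℤ) (d n : ℕ) : ℤ[X] :=
  ∑ j ∈ Finset.range d, C (remainderCoeff s α n j) * X ^ (d - 1 - j)

/-- The polynomial `s (n - 1) + s (n - 2) X + ⋯ + s 0 X ^ (n - 1)`. -/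
noncomputable def reversedPartialSum (s : ℕ → ℕ) (n : ℕ) : ℤ[X] :=
  ∑ j ∈ Finset.range n, C ((s (n - 1 - j) : ℤ)) * X ^ j

theorem remainderCoeff_zero (s : ℕ → ℕ) (α : ℕ → ℤ) (n : ℕ) :
    remainderCoeff s α n 0 = s n := by
  simp [remainderCoeff]

theorem remainderCoeff_succ (s : ℕ → ℕ) (α : ℕ → ℤ) (n j : ℕ) :
    remainderCoeff s α n (j + 1) = remainderCoeff s α (n + 1) j + α (j + 1) * s n := by
  unfold remainderCoeff
  rw [Finset.sum_range_succ]
  have h : ∑ i ∈ Finset.range j, α (i + 1) * (s (n + (j + 1 - 1 - i)) : ℤ) =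
      ∑ i ∈ Finset.range j, α (i + 1) * (s (n + 1 + (j - 1 - i)) : ℤ) := by
    refine Finset.sum_congr rfl fun i hi => ?_
    have := Finset.mem_range.1 hi
    rw [show n + (j + 1 - 1 - i) = n + 1 + (j - 1 - i) by omega]
  rw [h, show n + (j + 1) = n + 1 + j by omega, show n + (j + 1 - 1 - j) = n by omega]
  ring

theorem X_mul_remainderPoly (s : ℕ → ℕ) (α : ℕ → ℤ) (d n : ℕ)
    (hc : remainderCoeff s α n d = 0) :
    X * remainderPoly s α d n =
      C (s n : ℤ) * (X ^ d + ∑ j ∈ Finset.range d, C (α (d - j)) * X ^ j) +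
        remainderPoly s α d (n + 1) := by
  have h1 : X * remainderPoly s α d n =
      ∑ j ∈ Finset.range (d + 1), C (remainderCoeff s α n j) * X ^ (d - j) := by
    rw [Finset.sum_range_succ, hc, remainderPoly, Finset.mul_sum]
    simp only [map_zero, zero_mul, add_zero]
    refine Finset.sum_congr rfl fun j hj => ?_
    have := Finset.mem_range.1 hj
    rw [show d - j = (d - 1 - j) + 1 by omega, pow_succ]
    ring
  have h2 : ∑ j ∈ Finset.range d, C (α (d - j)) * X ^ j =
      ∑ j ∈ Finset.range d, C (α (j + 1)) * X ^ (d - 1 - j) := by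
    rw [← Finset.sum_range_reflect]
    refine Finset.sum_congr rfl fun j hj => ?_
    have := Finset.mem_range.1 hj
    rw [show d - (d - 1 - j) = j + 1 by omega]
  rw [h1, h2, Finset.sum_range_succ', remainderCoeff_zero, mul_add, Finset.mul_sum, remainderPoly,
    add_comm, add_assoc, ← Finset.sum_add_distrib]
  congr 1
  refine Finset.sum_congr rfl fun j _ => ?_
  rw [remainderCoeff_succ, show d - (j + 1) = d - 1 - j by omega]
  simp only [map_add, map_mul]
  ring

theorem reversedPartialSum_succ (s : ℕ → ℕ) (n : ℕ) :
    reversedPartialSum s (n + 1) = X * reversedPartialSum s n + C (s n : ℤ) := by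
  unfold reversedPartialSum
  rw [Finset.sum_range_succ', Finset.mul_sum]
  congr 1
  · refine Finset.sum_congr rfl fun j _ => ?_
    rw [show n + 1 - 1 - (j + 1) = n - 1 - j by omega]
    ring
  · simp

theorem X_pow_mul_remainderPoly (s : ℕ → ℕ) (α : ℕ → ℤ) (d : ℕ)
    (hc : ∀ n, remainderCoeff s α n d = 0) (n : ℕ) :
    X ^ n * remainderPoly s α d 0 =
      (X ^ d + ∑ j ∈ Finset.range d, C (α (d - j)) * X ^ j) * reversedPartialSum s n +
        remainderPoly s α d n := by
  induction n with
  | zero => simp [reversedPartialSum]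
  | succ n ih =>
    rw [pow_succ', mul_assoc, ih, mul_add, X_mul_remainderPoly s α d n (hc n),
      reversedPartialSum_succ]
    ring

theorem degree_remainderPoly_lt (s : ℕ → ℕ) (α : ℕ → ℤ) (d n : ℕ) :
    (remainderPoly s α d n).degree < d := by
  rw [degree_lt_iff_coeff_zero]
  intro m hm
  rw [remainderPoly, finsetSum_coeff]
  refine Finset.sum_eq_zero fun j hj => ?_
  have := Finset.mem_range.1 hj
  rw [coeff_C_mul, coeff_X_pow, if_neg (by omega), mul_zero]

theorem eq_remainderPoly_zero (s : ℕ → ℕ) (α : ℕ → ℤ) (d : ℕ)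
    (hc : ∀ n, remainderCoeff s α n d = 0) (B S A : ℤ[X])
    (hB : B = X ^ d + ∑ j ∈ Finset.range d, C (α (d - j)) * X ^ j)
    (hS : S = reversedPartialSum s d)
    (hA : B * S = (B * S) %ₘ X ^ d + X ^ d * A) :
    A = remainderPoly s α d 0 := by
  have h := X_pow_mul_remainderPoly s α d hc d
  rw [← hB, ← hS] at h
  have hu := div_modByMonic_unique (f := B * S) (g := X ^ d) (remainderPoly s α d 0)
    (-remainderPoly s α d d) (monic_X_pow d)
    ⟨by rw [h]; ring, by
      rw [degree_neg, degree_X_pow]; exact degree_remainderPoly_lt s α d d⟩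
  rw [hu.2] at hA
  have hX : (X ^ d : ℤ[X]) ≠ 0 := (monic_X_pow d).ne_zero
  apply mul_left_cancel₀ hX
  rw [h, hA]
  ring

/-- Exponential growth rate bounding the sequence `s`. -/
def growthBound (s : ℕ → ℕ) (α : ℕ → ℤ) (d : ℕ) : ℤ :=
  1 + ∑ i ∈ Finset.range d, |α (i + 1)| + ∑ i ∈ Finset.range d, (s i : ℤ)

theorem one_add_sum_abs_le_growthBound (s : ℕ → ℕ) (α : ℕ → ℤ) (d : ℕ) :
    1 + ∑ i ∈ Finset.range d, |α (i + 1)| ≤ growthBound s α d := by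
  have : (0 : ℤ) ≤ ∑ i ∈ Finset.range d, (s i : ℤ) :=
    Finset.sum_nonneg fun i _ => by positivity
  unfold growthBound
  linarith

theorem one_le_growthBound (s : ℕ → ℕ) (α : ℕ → ℤ) (d : ℕ) : 1 ≤ growthBound s α d := by
  have : (0 : ℤ) ≤ ∑ i ∈ Finset.range d, |α (i + 1)| :=
    Finset.sum_nonneg fun i _ => abs_nonneg _
  linarith [one_add_sum_abs_le_growthBound s α d]

theorem abs_sum_mul_le {ι : Type*} (t : Finset ι) (f g : ι → ℤ) (M : ℤ)
    (hg : ∀ i ∈ t, |g i| ≤ M) : |∑ i ∈ t, f i * g i| ≤ (∑ i ∈ t, |f i|) * M := by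
  rw [Finset.sum_mul]
  refine (Finset.abs_sum_le_sum_abs _ _).trans (Finset.sum_le_sum fun i hi => ?_)
  rw [abs_mul]
  exact mul_le_mul_of_nonneg_left (hg i hi) (abs_nonneg _)

theorem le_growthBound_pow (s : ℕ → ℕ) (α : ℕ → ℤ) (d : ℕ)
    (hc : ∀ n, remainderCoeff s α n d = 0) (n : ℕ) :
    (s n : ℤ) ≤ growthBound s α d ^ (n + 1) := by
  have hK := one_le_growthBound s α d
  induction n using Nat.strong_induction_on with
  | _ n ih =>
    rcases lt_or_ge n d with hn | hn
    · have h1 : (s n : ℤ) ≤ ∑ i ∈ Finset.range d, (s i : ℤ) :=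
        Finset.single_le_sum (f := fun i => (s i : ℤ)) (fun i _ => by positivity)
          (Finset.mem_range.2 hn)
      have h2 : (0 : ℤ) ≤ ∑ i ∈ Finset.range d, |α (i + 1)| :=
        Finset.sum_nonneg fun i _ => abs_nonneg _
      calc (s n : ℤ) ≤ growthBound s α d := by unfold growthBound; linarith
        _ ≤ _ := le_self_pow₀ hK (by omega)
    · obtain ⟨m, rfl⟩ := Nat.exists_eq_add_of_le' hn
      have h := hc m
      unfold remainderCoeff at h
      have hb := abs_sum_mul_le (Finset.range d) (fun i => α (i + 1))
        (fun i => (s (m + (d - 1 - i)) : ℤ)) (growthBound s α d ^ (m + d)) (fun i hi => by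
          have := Finset.mem_range.1 hi
          rw [abs_of_nonneg (by positivity)]
          exact (ih _ (by omega)).trans (pow_le_pow_right₀ hK (by omega)))
      have h3 := neg_abs_le (∑ i ∈ Finset.range d, α (i + 1) * (s (m + (d - 1 - i)) : ℤ))
      have h4 : (∑ i ∈ Finset.range d, |α (i + 1)|) * growthBound s α d ^ (m + d) ≤
          growthBound s α d * growthBound s α d ^ (m + d) :=
        mul_le_mul_of_nonneg_right (by linarith [one_add_sum_abs_le_growthBound s α d])
          (by positivity)
      rw [pow_succ']
      linarith

theorem abs_remainderCoeff_le (s : ℕ → ℕ) (α : ℕ → ℤ) (d : ℕ)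
    (hc : ∀ n, remainderCoeff s α n d = 0) (n j : ℕ) (hj : j < d) :
    |remainderCoeff s α n j| ≤ growthBound s α d ^ (n + d + 1) := by
  have hK := one_le_growthBound s α d
  have hb := abs_sum_mul_le (Finset.range j) (fun i => α (i + 1))
    (fun i => (s (n + (j - 1 - i)) : ℤ)) (growthBound s α d ^ (n + d)) (fun i hi => by
      have := Finset.mem_range.1 hi
      rw [abs_of_nonneg (by positivity)]
      exact (le_growthBound_pow s α d hc _).trans (pow_le_pow_right₀ hK (by omega)))
  have hs : (s (n + j) : ℤ) ≤ growthBound s α d ^ (n + d) :=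
    (le_growthBound_pow s α d hc _).trans (pow_le_pow_right₀ hK (by omega))
  have hsub : ∑ i ∈ Finset.range j, |α (i + 1)| ≤ ∑ i ∈ Finset.range d, |α (i + 1)| :=
    Finset.sum_le_sum_of_subset_of_nonneg (Finset.range_subset_range.2 hj.le)
      fun i _ _ => abs_nonneg _
  have h4 : (1 + ∑ i ∈ Finset.range j, |α (i + 1)|) * growthBound s α d ^ (n + d) ≤
      growthBound s α d * growthBound s α d ^ (n + d) :=
    mul_le_mul_of_nonneg_right (by linarith [one_add_sum_abs_le_growthBound s α d])
      (by positivity)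
  have h5 := abs_add_le (s (n + j) : ℤ)
    (∑ i ∈ Finset.range j, α (i + 1) * (s (n + (j - 1 - i)) : ℤ))
  rw [abs_of_nonneg (by positivity : (0 : ℤ) ≤ s (n + j))] at h5
  rw [pow_succ']
  unfold remainderCoeff
  linarith

theorem emod_ediv_eq_of_bounds {E Q T M N t : ℤ} (hE : E = M * Q + T) (hN : 0 < N) (ht : 0 ≤ t)
    (h1 : t * N ≤ T) (h2 : T < (t + 1) * N) (h3 : T < M) : t = E % M / N := by
  have hT : 0 ≤ T := (mul_nonneg ht hN.le).trans h1
  rw [hE, add_comm, Int.add_mul_emod_self_left, Int.emod_eq_of_lt hT h3]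
  apply le_antisymm
  · exact (Int.le_ediv_iff_mul_le hN).2 h1
  · exact Int.lt_add_one_iff.1 ((Int.ediv_lt_iff_lt_mul hN).2 h2)

theorem stmt_6 (s : ℕ → ℕ) (d : ℕ) (hd : 2 ≤ d) (α : ℕ → ℤ) (hαd : α d ≠ 0)
    (hrec : ∀ n : ℕ,
      (s (n + d) : ℤ) + ∑ i ∈ Finset.range d, α (i + 1) * (s (n + (d - 1 - i)) : ℤ) = 0)
    (B : ℤ[X]) (hB : B = X ^ d + ∑ j ∈ Finset.range d, Polynomial.C (α (d - j)) * X ^ j)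
    (S : ℤ[X]) (hS : S = ∑ j ∈ Finset.range d, Polynomial.C ((s (d - 1 - j) : ℤ)) * X ^ j)
    (A : ℤ[X]) (hA : B * S = (B * S) %ₘ X ^ d + X ^ d * A) :
    ∃ b₀ n₀ : ℕ, ∀ b : ℕ, b₀ ≤ b → ∀ n : ℕ, n₀ ≤ n →
      (s n : ℤ) =
        ((b : ℤ) ^ (n * (d - 2) + (n + 1) / 2) + (b : ℤ) ^ (n ^ 2) * A.eval ((b : ℤ) ^ n))
          % B.eval ((b : ℤ) ^ n) / (b : ℤ) ^ (n * (d - 1)) := by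
  have hc : ∀ n, remainderCoeff s α n d = 0 := hrec
  have hA0 := eq_remainderPoly_zero s α d hc B S A hB hS hA
  have hK := one_le_growthBound s α d
  set K := growthBound s α d with hKdef
  set G : ℤ := d * K ^ (d + 2) with hG
  have hd1 : (1 : ℤ) ≤ d := by exact_mod_cast (by omega : 1 ≤ d)
  have hG1 : 1 ≤ G := one_le_mul_of_one_le_of_one_le hd1 (one_le_pow₀ hK)
  refine ⟨(G ^ 2 + 3).toNat, 2, fun b hb n hn => ?_⟩
  have hb' : G ^ 2 + 3 ≤ b := Int.toNat_le.1 hb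
  have hb3 : (3 : ℤ) ≤ b := by nlinarith
  set x : ℤ := (b : ℤ) ^ n with hx
  set y : ℤ := (b : ℤ) ^ ((n + 1) / 2) with hy
  have hx0 : 0 < x := by positivity
  have hyx : 3 * y ≤ x := by
    calc 3 * y ≤ b * y := mul_le_mul_of_nonneg_right hb3 (by positivity)
      _ = (b : ℤ) ^ ((n + 1) / 2 + 1) := by rw [hy, pow_succ']
      _ ≤ x := pow_le_pow_right₀ (by linarith) (by omega)
  set D : ℤ := d * K ^ (n + d + 1) with hD
  have hDy : D ≤ y := by
    calc D ≤ G ^ n := by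
          rw [hD, hG, mul_pow, ← pow_mul]
          apply mul_le_mul (le_self_pow₀ hd1 (by omega)) (pow_le_pow_right₀ hK (by nlinarith))
            (by positivity) (by positivity)
      _ ≤ G ^ (2 * ((n + 1) / 2)) := pow_le_pow_right₀ hG1 (by omega)
      _ = (G ^ 2) ^ ((n + 1) / 2) := pow_mul _ _ _
      _ ≤ y := pow_le_pow_left₀ (by positivity) (by linarith) _
  have hpowD : K ^ (n + 1) ≤ D := by
    calc K ^ (n + 1) ≤ K ^ (n + d + 1) := pow_le_pow_right₀ hK (by omega)
      _ ≤ D := le_mul_of_one_le_left (by positivity) hd1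
  have hsn : (s n : ℤ) ≤ K ^ (n + 1) := le_growthBound_pow s α d hc n
  have hKn : K ≤ K ^ (n + 1) := le_self_pow₀ hK (by omega)
  obtain ⟨e, rfl⟩ := Nat.exists_eq_add_of_le' hd
  set low : ℤ := ∑ j ∈ Finset.range (e + 1), remainderCoeff s α n (j + 1) * x ^ (e - j) with hlow
  have heval : (remainderPoly s α (e + 2) n).eval x = s n * x ^ (e + 1) + low := by
    rw [remainderPoly, Finset.sum_range_succ', remainderCoeff_zero, hlow]
    simp only [eval_add, eval_finsetSum, eval_mul, eval_C, eval_pow, eval_X]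
    rw [add_comm]
    congr 1
    refine Finset.sum_congr rfl fun j _ => ?_
    rw [show e + 2 - 1 - (j + 1) = e - j by omega]
  have hx1 : 1 ≤ x := hx0
  have habs : |low| ≤ D * x ^ e := by
    refine (abs_sum_mul_le _ _ _ (x ^ e) fun j _ => ?_).trans ?_
    · rw [abs_of_nonneg (by positivity)]
      exact pow_le_pow_right₀ hx1 (by omega)
    · refine mul_le_mul_of_nonneg_right ?_ (by positivity)
      refine (Finset.sum_le_card_nsmul _ _ (K ^ (n + (e + 2) + 1)) fun j hj => ?_).trans ?_
      · have := Finset.mem_range.1 hj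
        exact abs_remainderCoeff_le s α (e + 2) hc n (j + 1) (by omega)
      · rw [Finset.card_range, nsmul_eq_mul, hD]
        refine mul_le_mul_of_nonneg_right ?_ (by positivity)
        push_cast
        linarith
  have hBx : x ^ (e + 2) - K * x ^ (e + 1) ≤ B.eval x := by
    rw [hB, ← Finset.sum_range_reflect]
    simp only [eval_add, eval_finsetSum, eval_mul, eval_C, eval_pow, eval_X]
    have h := abs_sum_mul_le (Finset.range (e + 2)) (fun j => α (e + 2 - (e + 2 - 1 - j)))
      (fun j => x ^ (e + 2 - 1 - j)) (x ^ (e + 1)) fun j _ => by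
        rw [abs_of_nonneg (by positivity)]
        exact pow_le_pow_right₀ hx1 (by omega)
    have hα : ∑ j ∈ Finset.range (e + 2), |α (e + 2 - (e + 2 - 1 - j))| =
        ∑ j ∈ Finset.range (e + 2), |α (j + 1)| := Finset.sum_congr rfl fun j hj => by
      have := Finset.mem_range.1 hj
      rw [show e + 2 - (e + 2 - 1 - j) = j + 1 by omega]
    rw [hα] at h
    have h2 : (∑ j ∈ Finset.range (e + 2), |α (j + 1)|) * x ^ (e + 1) ≤ K * x ^ (e + 1) :=
      mul_le_mul_of_nonneg_right (by linarith [one_add_sum_abs_le_growthBound s α (e + 2)])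
        (by positivity)
    have h3 := neg_abs_le (∑ j ∈ Finset.range (e + 2),
      α (e + 2 - (e + 2 - 1 - j)) * x ^ (e + 2 - 1 - j))
    linarith
  have hdiv := congrArg (eval x) (X_pow_mul_remainderPoly s α (e + 2) hc n)
  rw [← hA0, ← hB, eval_add, eval_mul, eval_mul, eval_pow, eval_X, heval] at hdiv
  have hxe : 0 < x ^ e := by positivity
  have hN : (b : ℤ) ^ (n * (e + 2 - 1)) = x ^ (e + 1) := by
    rw [hx, ← pow_mul]; rfl
  have hlow1 := (abs_le.1 habs).1
  have hlow2 := (abs_le.1 habs).2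
  have hDyx : D * x ^ e ≤ y * x ^ e := mul_le_mul_of_nonneg_right hDy hxe.le
  have hup : s n * x ^ (e + 1) + low + y * x ^ e < (s n + 1) * x ^ (e + 1) := by
    have : 3 * y * x ^ e ≤ x * x ^ e := mul_le_mul_of_nonneg_right hyx hxe.le
    have : 0 < y * x ^ e := by positivity
    rw [pow_succ' x e]
    linarith
  rw [hN]
  refine emod_ediv_eq_of_bounds (Q := (reversedPartialSum s n).eval x)
    (T := s n * x ^ (e + 1) + low + y * x ^ e) ?_ (by positivity) (by positivity) ?_ hup ?_
  · have h1 : (b : ℤ) ^ (n * (e + 2 - 2) + (n + 1) / 2) = y * x ^ e := by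
      rw [pow_add, pow_mul, Nat.add_sub_cancel, mul_comm]
    have h2 : (b : ℤ) ^ (n ^ 2) = x ^ n := by
      rw [hx, ← pow_mul, sq]
    rw [h1, h2, hdiv]
    ring
  · linarith
  · refine hup.trans_le (le_trans ?_ hBx)
    have : (s n + 1 + K) * x ^ (e + 1) ≤ x * x ^ (e + 1) :=
      mul_le_mul_of_nonneg_right (by linarith) (by positivity)
    rw [pow_succ' x (e + 1)]
    linarith
end

section
/- Let s : ℕ → ℕ be a C-recursive sequence of degree d ≥ 2 with integer coefficients α₁, …, α_d (α_d ≠ 0). Let B(X) = α_d + α_{d−1}X + ⋯ + α₁X^{d−1} + X^d ∈ ℤ[X], let S_{d−1}(X) = s(d−1) + s(d−2)X + ⋯ + s(0)X^{d−1}, and let A(X) ∈ ℤ[X] be the exact polynomial quotient of B(X)·S_{d−1}(X) by X^d. Then there exist natural numbers b₀ and n₀ such that for every natural number b ≥ b₀ and every integer n ≥ n₀: |α_d|·s(n) = ((b^{n(d−1)+⌈n/2⌉} − sgn(α_d)·b^{n(n+1)}·A(b^n)) mod B(b^n)) mod b^n, where sgn(α_d) ∈ {−1, 1} is the sign of α_d.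 -/
open Polynomial

/-- The polynomial part of `B(X) · ∑ k, u (m + k) X ^ (-k-1)`. -/
noncomputable def recurrenceTail (B : ℤ[X]) (d : ℕ) (u : ℕ → ℤ) (m : ℕ) : ℤ[X] :=
  ∑ j ∈ Finset.range d,
    C (∑ i ∈ Finset.range (d - j), B.coeff (j + 1 + i) * u (m + i)) * X ^ j

lemma coeff_sum_C_mul_X_pow (d : ℕ) (f : ℕ → ℤ) (j : ℕ) :
    (∑ k ∈ Finset.range d, C (f k) * X ^ k : ℤ[X]).coeff j = if j < d then f j else 0 := by
  simp [finsetSum_coeff, coeff_X_pow]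

lemma coeff_recurrenceTail (B : ℤ[X]) (d : ℕ) (u : ℕ → ℤ) (m j : ℕ) :
    (recurrenceTail B d u m).coeff j =
      ∑ i ∈ Finset.range (d - j), B.coeff (j + 1 + i) * u (m + i) := by
  rw [recurrenceTail, coeff_sum_C_mul_X_pow]
  split_ifs with h
  · rfl
  · simp [Nat.sub_eq_zero_of_le (not_lt.mp h)]

lemma X_mul_recurrenceTail {B : ℤ[X]} {d : ℕ} {u : ℕ → ℤ} (hB : ∀ k, d < k → B.coeff k = 0)
    (hu : ∀ m, ∑ i ∈ Finset.range (d + 1), B.coeff i * u (m + i) = 0) (m : ℕ) :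
    X * recurrenceTail B d u m = C (u m) * B + recurrenceTail B d u (m + 1) := by
  ext j
  rw [coeff_add, coeff_C_mul, coeff_recurrenceTail]
  cases j with
  | zero =>
    have h := hu m
    rw [Finset.sum_range_succ'] at h
    simp only [coeff_X_mul_zero, Nat.sub_zero]
    rw [← h, add_comm, mul_comm (u m)]
    refine congrArg₂ (· + ·) rfl (Finset.sum_congr rfl fun i _ => ?_)
    rw [show 0 + 1 + i = i + 1 by ring, show m + 1 + i = m + (i + 1) by ring]
  | succ j =>
    rw [coeff_X_mul, coeff_recurrenceTail]
    rcases lt_or_ge j d with h | h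
    · rw [show d - j = d - (j + 1) + 1 by omega, Finset.sum_range_succ', add_comm,
        mul_comm (u m)]
      refine congrArg₂ (· + ·) rfl (Finset.sum_congr rfl fun i _ => ?_)
      rw [show j + 1 + (i + 1) = j + 1 + 1 + i by ring, show m + (i + 1) = m + 1 + i by ring]
    · rw [hB (j + 1) (by omega), Nat.sub_eq_zero_of_le h,
        Nat.sub_eq_zero_of_le (show d ≤ j + 1 by omega)]
      simp

lemma X_pow_mul_recurrenceTail_zero {B : ℤ[X]} {d : ℕ} {u : ℕ → ℤ}
    (hB : ∀ k, d < k → B.coeff k = 0)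
    (hu : ∀ m, ∑ i ∈ Finset.range (d + 1), B.coeff i * u (m + i) = 0) (m : ℕ) :
    ∃ Q : ℤ[X], X ^ m * recurrenceTail B d u 0 = B * Q + recurrenceTail B d u m := by
  induction m with
  | zero => exact ⟨0, by simp⟩
  | succ m ih =>
    obtain ⟨Q, hQ⟩ := ih
    refine ⟨X * Q + C (u m), ?_⟩
    linear_combination X * hQ + X_mul_recurrenceTail hB hu m

/-- The quotient of `B · (u (d-1) + ⋯ + u 0 X ^ (d-1))` by `X ^ d` is the tail at index `0`. -/
lemma eq_recurrenceTail_zero {B S A : ℤ[X]} {d : ℕ} {u : ℕ → ℤ}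
    (hB : ∀ k, d < k → B.coeff k = 0)
    (hS : S = ∑ j ∈ Finset.range d, C (u (d - 1 - j)) * X ^ j)
    (hA : B * S = (B * S) %ₘ X ^ d + X ^ d * A) : A = recurrenceTail B d u 0 := by
  ext j
  have hr : ((B * S) %ₘ X ^ d).coeff (j + d) = 0 := by
    refine coeff_eq_zero_of_degree_lt
      ((degree_modByMonic_lt _ (monic_X_pow d)).trans_le ?_)
    rw [degree_X_pow]
    exact_mod_cast Nat.le_add_left d j
  have h := congrArg (fun p : ℤ[X] => p.coeff (j + d)) hA
  simp only [coeff_add, hr, zero_add, coeff_X_pow_mul] at h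
  rw [← h, coeff_recurrenceTail, coeff_mul, Finset.Nat.sum_antidiagonal_eq_sum_range_succ_mk,
    show (j + d).succ = j + 1 + d by omega, Finset.sum_range_add]
  have hS' : ∀ k, S.coeff k = if k < d then u (d - 1 - k) else 0 := fun k => by
    rw [hS, coeff_sum_C_mul_X_pow]
  rw [Finset.sum_eq_zero, zero_add]
  · symm
    refine (Finset.sum_subset (Finset.range_mono (Nat.sub_le d j)) fun i _ hi => ?_).trans
      (Finset.sum_congr rfl fun i hi => ?_)
    · rw [hB _ (by simp at hi; omega), zero_mul]
    · rw [Finset.mem_range] at hi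
      rw [hS', if_pos (by omega)]
      congr 2
      omega
  · intro k hk
    rw [Finset.mem_range] at hk
    rw [hS', if_neg (by omega), mul_zero]

lemma abs_le_mul_pow_of_recurrence {d : ℕ} {a : ℕ → ℤ} {u : ℕ → ℤ} {C M : ℤ}
    (hM : 1 + ∑ i ∈ Finset.range d, |a i| ≤ M) (hC : ∀ k < d, |u k| ≤ C) (hC0 : 0 ≤ C)
    (hu : ∀ n, u (n + d) + ∑ i ∈ Finset.range d, a i * u (n + (d - 1 - i)) = 0) (k : ℕ) :
    |u k| ≤ C * M ^ k := by
  have hM1 : 1 ≤ M := le_trans (le_add_of_nonneg_right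
    (Finset.sum_nonneg fun i _ => abs_nonneg (a i))) hM
  induction k using Nat.strong_induction_on with
  | _ k ih =>
    rcases lt_or_ge k d with h | h
    · exact (hC k h).trans (le_mul_of_one_le_right hC0 (one_le_pow₀ hM1))
    · obtain ⟨n, rfl⟩ := Nat.exists_eq_add_of_le' h
      rw [eq_neg_of_add_eq_zero_left (hu n), abs_neg]
      rcases Nat.eq_zero_or_pos d with rfl | hd
      · simp; positivity
      calc |∑ i ∈ Finset.range d, a i * u (n + (d - 1 - i))|
          ≤ ∑ i ∈ Finset.range d, |a i| * (C * M ^ (n + d - 1)) := by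
            refine (Finset.abs_sum_le_sum_abs _ _).trans (Finset.sum_le_sum fun i hi => ?_)
            rw [Finset.mem_range] at hi
            rw [abs_mul]
            gcongr
            refine (ih _ (by omega)).trans ?_
            gcongr
            omega
        _ ≤ M * (C * M ^ (n + d - 1)) := by
            rw [← Finset.sum_mul]
            gcongr
            linarith
        _ = C * M ^ (n + d) := by
            obtain ⟨e, rfl⟩ : ∃ e, d = e + 1 := ⟨d - 1, by omega⟩
            rw [show n + (e + 1) - 1 = n + e by omega]
            ring

lemma abs_eval_recurrenceTail_le {B : ℤ[X]} {d : ℕ} {u : ℕ → ℤ} {C M x : ℤ}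
    (hB : ∀ k, |B.coeff k| ≤ M) (hM : 1 ≤ M) (hC : 0 ≤ C) (hx : 1 ≤ x)
    (hu : ∀ k, |u k| ≤ C * M ^ k) (m : ℕ) :
    |(recurrenceTail B d u m).eval x| ≤ d * (d * (M * (C * M ^ (m + d)))) * x ^ (d - 1) := by
  rw [recurrenceTail, eval_finsetSum]
  refine (Finset.abs_sum_le_sum_abs _ _).trans
    ((Finset.sum_le_card_nsmul _ _ ((d * (M * (C * M ^ (m + d)))) * x ^ (d - 1))
      fun j hj => ?_).trans ?_)
  · rw [Finset.mem_range] at hj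
    rw [eval_mul, eval_C, eval_pow, eval_X, abs_mul, abs_pow, abs_of_nonneg (by linarith : 0 ≤ x)]
    gcongr
    · refine (Finset.abs_sum_le_sum_abs _ _).trans
        ((Finset.sum_le_card_nsmul _ _ (M * (C * M ^ (m + d))) fun i hi => ?_).trans ?_)
      · rw [Finset.mem_range] at hi
        rw [abs_mul]
        gcongr
        · exact hB _
        · refine (hu _).trans ?_
          gcongr
          omega
      · rw [Finset.card_range, nsmul_eq_mul]
        gcongr
        omega
    omega
  · rw [Finset.card_range, nsmul_eq_mul]
    exact (by ring : _ = _).le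

/-- `b ^ (n(d-1)+⌈n/2⌉)` dominates `T` and their sum stays below `b ^ (nd)`. -/
lemma pow_ceil_half_estimates {b n d : ℕ} {K M T D : ℤ} (hn : 2 ≤ n) (hK : 1 ≤ K) (hM : 1 ≤ M)
    (hD : 0 ≤ D) (hb : (K * M) ^ 2 + D + 3 ≤ b)
    (hT : |T| ≤ K * M ^ n * ((b : ℤ) ^ n) ^ (d - 1)) :
    |T| ≤ (b : ℤ) ^ (n * (d - 1) + (n + 1) / 2) ∧
      (b : ℤ) ^ (n * (d - 1) + (n + 1) / 2) + |T| <
        ((b : ℤ) ^ n) ^ (d - 1) * ((b : ℤ) ^ n - D) ∧ K * M ^ n < (b : ℤ) ^ n := by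
  set x : ℤ := (b : ℤ) ^ n with hx
  set c := (n + 1) / 2 with hc
  set y : ℤ := (b : ℤ) ^ c with hy
  have hKM : 1 ≤ K * M := one_le_mul_of_one_le_of_one_le hK hM
  have hb3 : (3 : ℤ) ≤ b := by nlinarith [sq_nonneg (K * M)]
  have hy1 : 1 ≤ y := one_le_pow₀ (by linarith)
  have hKy : K * M ^ n ≤ y := calc
    K * M ^ n ≤ K ^ n * M ^ n := by
      gcongr
      exact le_self_pow₀ hK (by omega)
    _ = (K * M) ^ n := (mul_pow _ _ _).symm
    _ ≤ (K * M) ^ (2 * c) := pow_le_pow_right₀ hKM (by omega)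
    _ = ((K * M) ^ 2) ^ c := pow_mul _ _ _
    _ ≤ y := pow_le_pow_left₀ (sq_nonneg _) (by linarith) c
  have hyx : b * y ≤ x := by
    rw [hx, hy, ← pow_succ']
    exact pow_le_pow_right₀ (by linarith) (by omega)
  have hxpos : 0 < x := by positivity
  have hxd : 0 < x ^ (d - 1) := by positivity
  have he : (b : ℤ) ^ (n * (d - 1) + c) = x ^ (d - 1) * y := by
    rw [pow_add, pow_mul]
  have hTy : |T| ≤ x ^ (d - 1) * y := by
    rw [mul_comm]
    exact hT.trans (by gcongr)
  have hbig : 2 * y + D < x := by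
    have : (D + 3) * y ≤ b * y := by
      gcongr
      nlinarith [sq_nonneg (K * M)]
    nlinarith
  rw [he]
  refine ⟨hTy, ?_, by linarith⟩
  have := mul_lt_mul_of_pos_left (show 2 * y < x - D by linarith) hxd
  linarith

lemma le_eval_monic {d : ℕ} {f : ℕ → ℤ} {M x : ℤ} (hd : 1 ≤ d) (hf : ∀ j < d, |f j| ≤ M)
    (hM : 0 ≤ M) (hx : 1 ≤ x) :
    x ^ (d - 1) * (x - d * M) ≤
      (X ^ d + ∑ j ∈ Finset.range d, C (f j) * X ^ j : ℤ[X]).eval x := by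
  have h : |∑ j ∈ Finset.range d, f j * x ^ j| ≤ d * (M * x ^ (d - 1)) := by
    refine (Finset.abs_sum_le_sum_abs _ _).trans
      ((Finset.sum_le_card_nsmul _ _ (M * x ^ (d - 1)) fun j hj => ?_).trans ?_)
    · rw [Finset.mem_range] at hj
      rw [abs_mul, abs_pow, abs_of_nonneg (by linarith : 0 ≤ x)]
      gcongr
      · exact hf j hj
      omega
    · rw [Finset.card_range, nsmul_eq_mul]
  have h' := neg_le_of_abs_le h
  simp only [eval_add, eval_pow, eval_X, eval_finsetSum, eval_mul, eval_C]
  have hxd : x ^ d = x ^ (d - 1) * x := by rw [← pow_succ, Nat.sub_add_cancel hd]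
  rw [hxd]
  linarith


/-- Remainder-remainder representation: for a C-recursive sequence `s : ℕ → ℕ` of degree
`d ≥ 2` with integer coefficients, `B(X) = α_d + ⋯ + α₁ X^(d-1) + X^d`,
`S(X) = s (d-1) + s (d-2) X + ⋯ + s 0 X^(d-1)` and `A` the exact quotient of `B · S`
by `X^d`, there exist `b₀, n₀` such that for all `b ≥ b₀` and `n ≥ n₀`:
`|α_d| · s n = ((b^(n(d-1)+⌈n/2⌉) - sgn(α_d) · b^(n(n+1)) · A(b^n)) mod B(b^n)) mod b^n`. -/
theorem stmt_7 (s : ℕ → ℕ) (d : ℕ) (hd : 2 ≤ d) (α : ℕ → ℤ) (hαd : α d ≠ 0)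
    (hrec : ∀ n : ℕ,
      (s (n + d) : ℤ) + ∑ i ∈ Finset.range d, α (i + 1) * (s (n + (d - 1 - i)) : ℤ) = 0)
    (B : ℤ[X]) (hB : B = X ^ d + ∑ j ∈ Finset.range d, Polynomial.C (α (d - j)) * X ^ j)
    (S : ℤ[X]) (hS : S = ∑ j ∈ Finset.range d, Polynomial.C ((s (d - 1 - j) : ℤ)) * X ^ j)
    (A : ℤ[X]) (hA : B * S = (B * S) %ₘ X ^ d + X ^ d * A) :
    ∃ b₀ n₀ : ℕ, ∀ b : ℕ, b₀ ≤ b → ∀ n : ℕ, n₀ ≤ n →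
      |α d| * (s n : ℤ) =
        ((b : ℤ) ^ (n * (d - 1) + (n + 1) / 2)
            - Int.sign (α d) * (b : ℤ) ^ (n * (n + 1)) * A.eval ((b : ℤ) ^ n))
          % B.eval ((b : ℤ) ^ n) % (b : ℤ) ^ n := by

  set u : ℕ → ℤ := fun n => (s n : ℤ) with hu
  set M : ℤ := 1 + ∑ i ∈ Finset.range d, |α (i + 1)| with hM
  set K₀ : ℤ := 1 + ∑ k ∈ Finset.range d, |u k| with hK₀
  have hM1 : 1 ≤ M := le_add_of_nonneg_right (Finset.sum_nonneg fun i _ => abs_nonneg _)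
  have hK₀1 : 1 ≤ K₀ := le_add_of_nonneg_right (Finset.sum_nonneg fun i _ => abs_nonneg _)
  have hαM : ∀ i < d, |α (i + 1)| ≤ M := fun i hi =>
    (Finset.single_le_sum (f := fun i => |α (i + 1)|) (fun i _ => abs_nonneg _)
      (Finset.mem_range.mpr hi)).trans (by linarith)
  have hαM' : ∀ j < d, |α (d - j)| ≤ M := fun j hj => by
    have := hαM (d - j - 1) (by omega)
    rwa [show d - j - 1 + 1 = d - j by omega] at this
  have huK : ∀ k, |u k| ≤ K₀ * M ^ k :=
    abs_le_mul_pow_of_recurrence (a := fun i => α (i + 1)) le_rfl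
      (fun k hk => (Finset.single_le_sum (f := fun i => |u i|) (fun i _ => abs_nonneg _)
        (Finset.mem_range.mpr hk)).trans (by linarith)) (by linarith) hrec
  have hBc : ∀ k, B.coeff k = if k = d then 1 else if k < d then α (d - k) else 0 := by
    intro k
    rw [hB, coeff_add, coeff_X_pow, coeff_sum_C_mul_X_pow d fun j => α (d - j)]
    split_ifs <;> omega
  have hBM : ∀ k, |B.coeff k| ≤ M := fun k => by
    rw [hBc]
    split_ifs with h₁ h₂
    · simpa using hM1
    · exact hαM' k h₂
    · simp; linarith
  have hB0 : ∀ k, d < k → B.coeff k = 0 := fun k hk => by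
    rw [hBc, if_neg (by omega), if_neg (by omega)]
  have hrec' : ∀ m, ∑ i ∈ Finset.range (d + 1), B.coeff i * u (m + i) = 0 := by
    intro m
    rw [← hrec m, Finset.sum_range_succ, hBc d, if_pos rfl, one_mul, add_comm,
      ← Finset.sum_range_reflect]
    refine congrArg₂ (· + ·) rfl (Finset.sum_congr rfl fun i hi => ?_)
    rw [Finset.mem_range] at hi
    rw [hBc, if_neg (by omega), if_pos (by omega), show d - (d - 1 - i) = i + 1 by omega]
  have hA0 : A = recurrenceTail B d u 0 := eq_recurrenceTail_zero hB0 hS hA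
  set K : ℤ := d * (d * (M * (K₀ * M ^ (d + 1)))) with hK
  have hd1 : (1 : ℤ) ≤ d := by exact_mod_cast (by omega : 1 ≤ d)
  have hMK : M * K₀ ≤ K := calc
    M * K₀ = 1 * (1 * (M * (K₀ * 1))) := by ring
    _ ≤ K := by
      rw [hK]
      gcongr
      exact one_le_pow₀ hM1
  have hK1 : 1 ≤ K := (one_le_mul_of_one_le_of_one_le hM1 hK₀1).trans hMK
  refine ⟨((K * M) ^ 2 + d * M + 3).toNat, 2, fun b hb n hn => ?_⟩
  have hb' : (K * M) ^ 2 + d * M + 3 ≤ (b : ℤ) := Int.toNat_le.mp hb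
  have hb1 : (1 : ℤ) ≤ b := by nlinarith [sq_nonneg (K * M)]
  set x : ℤ := (b : ℤ) ^ n with hx
  have hx1 : 1 ≤ x := one_le_pow₀ hb1
  set T : ℤ := (recurrenceTail B d u (n + 1)).eval x with hT
  have hTb : |T| ≤ K * M ^ n * x ^ (d - 1) := by
    refine (abs_eval_recurrenceTail_le hBM hM1 (by linarith) hx1 huK (n + 1)).trans_eq ?_
    rw [hK]
    ring
  obtain ⟨hT1, hT2, hxK⟩ :=
    pow_ceil_half_estimates (D := d * M) hn hK1 hM1 (by positivity) hb' hTb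
  have hBx : x ^ (d - 1) * (x - d * M) ≤ B.eval x := by
    rw [hB]
    exact le_eval_monic (by omega) hαM' (by linarith) hx1
  obtain ⟨Q, hQ⟩ := X_pow_mul_recurrenceTail_zero hB0 hrec' (n + 1)
  have hQ' : x ^ (n + 1) * A.eval x = B.eval x * Q.eval x + T := by
    have := congrArg (eval x) hQ
    rwa [← hA0, eval_add, eval_mul, eval_mul, eval_pow, eval_X] at this
  have hσT : |Int.sign (α d) * T| = |T| := by
    rw [abs_mul, Int.abs_sign_of_ne_zero hαd, one_mul]
  have hmod : ((b : ℤ) ^ (n * (d - 1) + (n + 1) / 2)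
      - Int.sign (α d) * (b : ℤ) ^ (n * (n + 1)) * A.eval x) % B.eval x
      = (b : ℤ) ^ (n * (d - 1) + (n + 1) / 2) - Int.sign (α d) * T := by
    rw [pow_mul (b : ℤ) n (n + 1), mul_assoc, hQ',
      ← Int.emod_eq_of_lt (b := B.eval x)
        (sub_nonneg.mpr ((le_abs_self _).trans (hσT.trans_le hT1)))
        (by linarith [neg_abs_le (Int.sign (α d) * T)])]
    refine Int.ModEq.symm (Int.modEq_iff_dvd.mpr ⟨-(Int.sign (α d) * Q.eval x), ?_⟩)
    ring
  rw [hmod]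
  have hsb : |α d| * u n < x := calc
    |α d| * u n ≤ M * (K₀ * M ^ n) := by
      have h1 := hαM' 0 (by omega)
      rw [Nat.sub_zero] at h1
      gcongr
      exact (le_abs_self _).trans (huK n)
    _ = M * K₀ * M ^ n := by ring
    _ ≤ K * M ^ n := by gcongr
    _ < x := hxK
  change |α d| * u n = _
  rw [← Int.emod_eq_of_lt (b := x) (mul_nonneg (abs_nonneg _) (Int.natCast_nonneg _)) hsb]
  have hstep : x * (recurrenceTail B d u n).eval x = u n * B.eval x + T := by
    have := congrArg (eval x) (X_mul_recurrenceTail hB0 hrec' n)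
    rwa [eval_add, eval_mul, eval_mul, eval_X, eval_C] at this
  obtain ⟨w, hw⟩ : x ∣ B.eval x - α d := by
    have := B.sub_dvd_eval_sub x 0
    rwa [sub_zero, ← coeff_zero_eq_eval_zero, hBc, if_neg (by omega), if_pos (by omega),
      Nat.sub_zero] at this
  obtain ⟨v, hv⟩ : x ∣ (b : ℤ) ^ (n * (d - 1) + (n + 1) / 2) :=
    pow_dvd_pow _ (le_add_right (Nat.le_mul_of_pos_right n (by omega)))
  refine Int.modEq_iff_dvd.mpr
    ⟨v - Int.sign (α d) * (recurrenceTail B d u n).eval x + Int.sign (α d) * u n * w, ?_⟩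
  linear_combination hv + Int.sign (α d) * hstep + Int.sign (α d) * u n * hw
    + u n * Int.sign_mul_self_eq_abs (α d)
end

section
/- For every C-recursive sequence s : ℕ → ℤ of degree d with integer coefficients α₁, …, α_d (α_d ≠ 0), there exists a natural number c ≥ 1 such that the sequence u defined by u(n) = s(n) + c^{n+1} satisfies u(n) ≥ 0 for all n ≥ 0, and u is C-recursive of degree d+1: writing (X − c)·(X^d + α₁X^{d−1} + ⋯ + α_d) = X^{d+1} + γ₁X^d + ⋯ + γ_{d+1}, one has u(n+d+1) + γ₁·u(n+d) + ⋯ + γ_{d+1}·u(n) = 0 for every n ≥ 0. -/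
open Polynomial

/-- The functional `∑ aₖ Xᵏ ↦ ∑ aₖ u (n + k)` attached to a sequence `u`. -/
noncomputable def shiftPairing (u : ℕ → ℤ) (n : ℕ) : ℤ[X] →ₗ[ℤ] ℤ :=
  Polynomial.lsum fun k => LinearMap.mulRight ℤ (u (n + k))

lemma shiftPairing_eq_sum (u : ℕ → ℤ) (n : ℕ) (p : ℤ[X]) :
    shiftPairing u n p = p.sum fun k a => a * u (n + k) := rfl

lemma shiftPairing_monomial (u : ℕ → ℤ) (n k : ℕ) (a : ℤ) :
    shiftPairing u n (monomial k a) = a * u (n + k) := by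
  rw [shiftPairing_eq_sum, sum_monomial_index _ _ (by simp)]

lemma shiftPairing_X_pow (u : ℕ → ℤ) (n k : ℕ) :
    shiftPairing u n (X ^ k) = u (n + k) := by
  rw [← monomial_one_right_eq_X_pow, shiftPairing_monomial, one_mul]

lemma shiftPairing_C_mul (u : ℕ → ℤ) (n : ℕ) (a : ℤ) (p : ℤ[X]) :
    shiftPairing u n (C a * p) = a * shiftPairing u n p := by
  rw [← smul_eq_C_mul, map_smul, smul_eq_mul]

lemma shiftPairing_X_mul (u : ℕ → ℤ) (n : ℕ) (p : ℤ[X]) :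
    shiftPairing u n (X * p) = shiftPairing u (n + 1) p := by
  induction p using Polynomial.induction_on' with
  | add p q hp hq => rw [mul_add, map_add, map_add, hp, hq]
  | monomial k a =>
    rw [X_mul_monomial, shiftPairing_monomial, shiftPairing_monomial]
    congr 2
    ring

lemma shiftPairing_eq_of_monic (u : ℕ → ℤ) (n d : ℕ) {p : ℤ[X]} (hp : p.Monic)
    (hdeg : p.natDegree = d + 1) :
    shiftPairing u n p =
      u (n + (d + 1)) + ∑ j ∈ Finset.range (d + 1), p.coeff (d - j) * u (n + (d - j)) := by
  have hlead : p.coeff (d + 1) = 1 := hdeg ▸ hp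
  rw [shiftPairing_eq_sum, sum_over_range' _ (by simp) (d + 2) (by omega),
    Finset.sum_range_succ, hlead, one_mul, add_comm, ← Finset.sum_range_reflect]
  rfl

lemma degree_sum_C_mul_X_pow_lt (d : ℕ) (α : ℕ → ℤ) :
    (∑ i ∈ Finset.range d, C (α (i + 1)) * X ^ (d - 1 - i) : ℤ[X]).degree < d := by
  rw [← mem_degreeLT]
  refine Submodule.sum_mem _ fun i hi => mem_degreeLT.2 ?_
  refine (degree_C_mul_X_pow_le _ _).trans_lt ?_
  have := Finset.mem_range.1 hi
  exact_mod_cast (by omega : d - 1 - i < d)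

/-- An integer sequence satisfying a linear recurrence grows at most geometrically. -/
lemma exists_abs_le_pow_of_linear_recurrence (s : ℕ → ℤ) (d : ℕ) (α : ℕ → ℤ)
    (hrec : ∀ n : ℕ,
      s (n + d) + ∑ i ∈ Finset.range d, α (i + 1) * s (n + (d - 1 - i)) = 0) :
    ∃ c : ℕ, 1 ≤ c ∧ ∀ n : ℕ, |s n| ≤ (c : ℤ) ^ (n + 1) := by
  set A : ℕ := ∑ i ∈ Finset.range d, (α (i + 1)).natAbs with hA
  set M : ℕ := ∑ k ∈ Finset.range d, (s k).natAbs
  refine ⟨A + M + 1, by omega, fun n => ?_⟩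
  set c : ℕ := A + M + 1 with hc
  have hc1 : (1 : ℤ) ≤ c := by exact_mod_cast (by omega : 1 ≤ c)
  induction n using Nat.strong_induction_on with
  | _ n ih =>
  rcases lt_or_ge n d with hn | hn
  · have h1 : (s n).natAbs ≤ M :=
      Finset.single_le_sum (f := fun k => (s k).natAbs) (fun _ _ => Nat.zero_le _)
        (Finset.mem_range.2 hn)
    calc |s n| ≤ (c : ℤ) := by rw [Int.abs_eq_natAbs]; exact_mod_cast (by omega)
      _ ≤ (c : ℤ) ^ (n + 1) := le_self_pow₀ hc1 (by omega)
  · obtain ⟨m, rfl⟩ := Nat.exists_eq_add_of_le' hn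
    rw [eq_neg_of_add_eq_zero_left (hrec m), abs_neg]
    calc |∑ i ∈ Finset.range d, α (i + 1) * s (m + (d - 1 - i))|
        ≤ ∑ i ∈ Finset.range d, |α (i + 1) * s (m + (d - 1 - i))| :=
          Finset.abs_sum_le_sum_abs _ _
      _ ≤ ∑ i ∈ Finset.range d, |α (i + 1)| * (c : ℤ) ^ (m + d) := by
          refine Finset.sum_le_sum fun i hi => ?_
          have hi := Finset.mem_range.1 hi
          rw [abs_mul]
          refine mul_le_mul_of_nonneg_left ?_ (abs_nonneg _)
          exact (ih _ (by omega)).trans (pow_le_pow_right₀ hc1 (by omega))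
      _ = (A : ℤ) * (c : ℤ) ^ (m + d) := by
          rw [← Finset.sum_mul, hA]
          push_cast
          rfl
      _ ≤ (c : ℤ) * (c : ℤ) ^ (m + d) :=
          mul_le_mul_of_nonneg_right (by exact_mod_cast (by omega : A ≤ c)) (by positivity)
      _ = (c : ℤ) ^ (m + d + 1) := by ring

/-- For every C-recursive sequence `s : ℕ → ℤ` of degree `d` with integer coefficients,
there is a natural number `c ≥ 1` such that `u n = s n + c^(n+1)` is nonnegative for all
`n`, and `u` satisfies the degree `d+1` recurrence whose coefficients `γ₁, …, γ_{d+1}`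
are given by `(X - c) · (X^d + α₁ X^(d-1) + ⋯ + α_d) = X^(d+1) + γ₁ X^d + ⋯ + γ_{d+1}`. -/
theorem stmt_9 (s : ℕ → ℤ) (d : ℕ) (hd : 1 ≤ d) (α : ℕ → ℤ) (hαd : α d ≠ 0)
    (hrec : ∀ n : ℕ, s (n + d) + ∑ i ∈ Finset.range d, α (i + 1) * s (n + (d - 1 - i)) = 0) :
    ∃ c : ℕ, 1 ≤ c ∧
      (∀ n : ℕ, 0 ≤ s n + (c : ℤ) ^ (n + 1)) ∧
      (∀ n : ℕ,
        (s (n + (d + 1)) + (c : ℤ) ^ (n + (d + 1) + 1)) +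
          ∑ j ∈ Finset.range (d + 1),
            ((X - Polynomial.C (c : ℤ)) *
              (X ^ d + ∑ i ∈ Finset.range d, Polynomial.C (α (i + 1)) * X ^ (d - 1 - i))).coeff (d - j)
              * (s (n + (d - j)) + (c : ℤ) ^ (n + (d - j) + 1)) = 0) := by
  obtain ⟨c, hc, hbound⟩ := exists_abs_le_pow_of_linear_recurrence s d α hrec
  refine ⟨c, hc, fun n => by linarith [neg_abs_le (s n), hbound n], fun n => ?_⟩
  have hlt := degree_sum_C_mul_X_pow_lt d α
  have hmonic : (X ^ d + ∑ i ∈ Finset.range d, C (α (i + 1)) * X ^ (d - 1 - i) : ℤ[X]).Monic :=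
    monic_X_pow_add hlt
  have hdeg : (X ^ d + ∑ i ∈ Finset.range d, C (α (i + 1)) * X ^ (d - 1 - i) :
      ℤ[X]).natDegree = d := by
    apply natDegree_eq_of_degree_eq_some
    rw [degree_add_eq_left_of_degree_lt (by rwa [degree_X_pow]), degree_X_pow]
  have hdeg' : ((X - C (c : ℤ)) *
      (X ^ d + ∑ i ∈ Finset.range d, C (α (i + 1)) * X ^ (d - 1 - i))).natDegree = d + 1 := by
    rw [(monic_X_sub_C _).natDegree_mul hmonic, natDegree_X_sub_C, hdeg, add_comm]
  have hpair (m : ℕ) : shiftPairing (fun k => s k + (c : ℤ) ^ (k + 1)) m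
      (X ^ d + ∑ i ∈ Finset.range d, C (α (i + 1)) * X ^ (d - 1 - i)) =
      (c : ℤ) ^ m * ((c : ℤ) ^ (d + 1) +
        ∑ i ∈ Finset.range d, α (i + 1) * (c : ℤ) ^ (d - 1 - i + 1)) := by
    simp only [map_add, map_sum, shiftPairing_C_mul, shiftPairing_X_pow, mul_add,
      Finset.sum_add_distrib, Finset.mul_sum]
    rw [add_add_add_comm, hrec m, zero_add]
    congr 1
    · ring
    · exact Finset.sum_congr rfl fun i _ => by ring
  rw [← shiftPairing_eq_of_monic (fun k => s k + (c : ℤ) ^ (k + 1)) n d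
    ((monic_X_sub_C _).mul hmonic) hdeg', sub_mul, map_sub, shiftPairing_X_mul,
    shiftPairing_C_mul, hpair, hpair]
  ring
end

section
/- Let s : ℕ → ℤ be a C-recursive sequence of degree d ≥ 2 with integer coefficients α₁, …, α_d (α_d ≠ 0), and let c ≥ 1 be a natural number such that |s(n)| < c^{n+1} for all n ≥ 0 and such that u(n) = s(n) + c^{n+1} is a C-recursive sequence of natural numbers of degree d+1 whose recurrence polynomial is B(X) = (X − c)·(X^d + α₁X^{d−1} + ⋯ + α_d) written with ascending-coefficient form B(X) = γ_{d+1} + γ_d X + ⋯ + γ₁X^d + X^{d+1}. Let U_d(X) = u(d) + u(d−1)X + ⋯ + u(0)X^d and let A(X) ∈ ℤ[X] be the exact polynomial quotient of B(X)·U_d(X) by X^{d+1}. Then there exist natural numbers b₀ and n₀ such that for every b ≥ b₀ and every n ≥ n₀: s(n) = ⌊((b^{n(d−1)+⌈n/2⌉} + b^{n²}·A(b^n)) mod B(b^n)) / b^{nd}⌋ − c^{n+1}. -/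
open Polynomial

/-- The shift operator on integer sequences. -/
def shiftMap : (ℕ → ℤ) →ₗ[ℤ] (ℕ → ℤ) where
  toFun f n := f (n + 1)
  map_add' _ _ := rfl
  map_smul' _ _ := rfl

lemma shiftMap_pow_apply (k : ℕ) (f : ℕ → ℤ) (n : ℕ) : (shiftMap ^ k) f n = f (n + k) := by
  induction k generalizing n with
  | zero => simp
  | succ k ih =>
    rw [pow_succ', Module.End.mul_apply]
    change (shiftMap ^ k) f (n + 1) = _
    rw [ih, add_right_comm, add_assoc]

lemma aeval_shiftMap_apply (P : ℤ[X]) (f : ℕ → ℤ) (n : ℕ) {N : ℕ} (hN : P.natDegree < N) :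
    aeval shiftMap P f n = ∑ k ∈ Finset.range N, P.coeff k * f (n + k) := by
  rw [aeval_eq_sum_range' hN, LinearMap.sum_apply, Finset.sum_apply]
  simp [shiftMap_pow_apply]

lemma degree_sum_descending_lt {d : ℕ} (hd : 0 < d) (α : ℕ → ℤ) :
    (∑ i ∈ Finset.range d, C (α (i + 1)) * X ^ (d - 1 - i)).degree < (d : WithBot ℕ) := by
  refine (degree_sum_le _ _).trans_lt ?_
  rw [Finset.sup_lt_iff (by exact_mod_cast WithBot.bot_lt_coe d)]
  intro i _
  refine (degree_C_mul_X_pow_le _ _).trans_lt ?_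
  exact_mod_cast (by omega : d - 1 - i < d)

/-- The sum of a linearly recurrent sequence and a multiple of `c ^ n` is annihilated by `X - c`
times the recurrence polynomial. -/
lemma aeval_shiftMap_mul_eq_zero {s u : ℕ → ℤ} {c : ℤ} {P : ℤ[X]}
    (hs : aeval shiftMap P s = 0) (hu : ∀ n, u n = s n + c ^ (n + 1)) :
    aeval shiftMap ((X - C c) * P) u = 0 := by
  have hu' : u = s + fun n => c ^ (n + 1) := funext hu
  have hc : aeval shiftMap (X - C c) (fun n => c ^ (n + 1)) = 0 := by
    funext n
    simp [shiftMap, pow_succ, mul_comm]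
  rw [hu', map_add, map_mul, Module.End.mul_apply, hs, map_zero, zero_add, ← map_mul, mul_comm,
    map_mul, Module.End.mul_apply, hc, map_zero]

lemma coeff_of_eq_modByMonic_add {d : ℕ} {u : ℕ → ℤ} {B U A : ℤ[X]}
    (hU : U = ∑ j ∈ Finset.range (d + 1), C (u (d - j)) * X ^ j)
    (hA : B * U = (B * U) %ₘ X ^ (d + 1) + X ^ (d + 1) * A) (j : ℕ) :
    A.coeff j = ∑ k ∈ Finset.range (d + 1), B.coeff (j + 1 + k) * u k := by
  have hmod : ((B * U) %ₘ X ^ (d + 1)).coeff (j + (d + 1)) = 0 := by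
    apply coeff_eq_zero_of_degree_lt
    refine (degree_modByMonic_lt _ (monic_X_pow _)).trans_le ?_
    rw [degree_X_pow]
    exact_mod_cast Nat.le_add_left _ _
  have h := congrArg (fun p : ℤ[X] => p.coeff (j + (d + 1))) hA
  simp only [coeff_add, hmod, zero_add, coeff_X_pow_mul] at h
  rw [← h, hU, Finset.mul_sum, finsetSum_coeff, ← Finset.sum_range_reflect]
  refine Finset.sum_congr rfl fun k hk => ?_
  have hk' : k ≤ d := by simpa [Nat.lt_succ_iff] using hk
  have e : j + (d + 1) = (j + 1 + k) + (d + 1 - 1 - k) := by omega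
  rw [← mul_assoc, e, coeff_mul_X_pow, coeff_mul_C]
  congr 2
  omega

/-- Division of `X ^ n * A` by the recurrence polynomial `B`, with the coefficients of the
remainder expressed through the sequence. -/
lemma exists_X_pow_mul_eq {d : ℕ} {u : ℕ → ℤ} {A B : ℤ[X]} (hdeg : B.natDegree = d + 1)
    (hrec : ∀ n, ∑ k ∈ Finset.range (d + 2), B.coeff k * u (n + k) = 0)
    (hA : ∀ j, A.coeff j = ∑ k ∈ Finset.range (d + 1), B.coeff (j + 1 + k) * u k) (n : ℕ) :
    ∃ Q R : ℤ[X], X ^ n * A = B * Q + R ∧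
      ∀ j, R.coeff j = ∑ k ∈ Finset.range (d + 1), B.coeff (j + 1 + k) * u (n + k) := by
  induction n with
  | zero => exact ⟨0, A, by simp, by simpa using hA⟩
  | succ n ih =>
    obtain ⟨Q, R, hQR, hR⟩ := ih
    refine ⟨X * Q + C (u n), X * R - C (u n) * B, ?_, ?_⟩
    · rw [pow_succ', mul_assoc, hQR]
      ring
    · rintro (_ | j)
      · have h := hrec n
        rw [Finset.sum_range_succ'] at h
        have e : ∑ k ∈ Finset.range (d + 1), B.coeff (0 + 1 + k) * u (n + 1 + k) =
            ∑ k ∈ Finset.range (d + 1), B.coeff (k + 1) * u (n + (k + 1)) :=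
          Finset.sum_congr rfl fun k _ => by
            rw [show 0 + 1 + k = k + 1 by omega, show n + 1 + k = n + (k + 1) by omega]
        rw [e, coeff_sub, coeff_X_mul_zero, coeff_C_mul]
        simp only [add_zero] at h
        linarith
      · rw [coeff_sub, coeff_X_mul, coeff_C_mul, hR, Finset.sum_range_succ', Finset.sum_range_succ,
          coeff_eq_zero_of_natDegree_lt (p := B) (n := j + 1 + 1 + d) (by omega)]
        have e : ∑ k ∈ Finset.range d, B.coeff (j + 1 + 1 + k) * u (n + 1 + k) =
            ∑ k ∈ Finset.range d, B.coeff (j + 1 + (k + 1)) * u (n + (k + 1)) :=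
          Finset.sum_congr rfl fun k _ => by
            rw [show j + 1 + 1 + k = j + 1 + (k + 1) by omega,
              show n + 1 + k = n + (k + 1) by omega]
        rw [e]
        simp only [add_zero]
        ring

lemma exists_abs_coeff_le (B : ℤ[X]) : ∃ K : ℕ, 1 ≤ K ∧ ∀ i, |B.coeff i| ≤ K := by
  refine ⟨1 + ∑ i ∈ B.support, (B.coeff i).natAbs, by omega, fun i => ?_⟩
  by_cases hi : i ∈ B.support
  · have := Finset.single_le_sum (f := fun i => (B.coeff i).natAbs) (fun _ _ => Nat.zero_le _) hi
    rw [Int.abs_eq_natAbs]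
    exact_mod_cast this.trans (Nat.le_add_left _ _)
  · rw [notMem_support_iff.mp hi, abs_zero]
    positivity

/-- A sum of lower-order terms with coefficients bounded by `W` is at most `m * W` times the top
power. -/
lemma abs_sum_mul_pow_le {m : ℕ} {a : ℕ → ℤ} {W x : ℤ} (hx : 1 ≤ x)
    (ha : ∀ j, |a j| ≤ W) :
    |∑ j ∈ Finset.range m, a j * x ^ j| ≤ m * W * x ^ (m - 1) := by
  have hW : 0 ≤ W := (abs_nonneg _).trans (ha 0)
  calc |∑ j ∈ Finset.range m, a j * x ^ j| ≤ ∑ j ∈ Finset.range m, |a j * x ^ j| :=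
        Finset.abs_sum_le_sum_abs _ _
    _ ≤ ∑ _j ∈ Finset.range m, W * x ^ (m - 1) := Finset.sum_le_sum fun j hj => by
        rw [abs_mul, abs_of_nonneg (by positivity : (0 : ℤ) ≤ x ^ j)]
        have : j ≤ m - 1 := by have := Finset.mem_range.mp hj; omega
        gcongr
        · exact ha j
    _ = m * W * x ^ (m - 1) := by simp [mul_assoc]

/-- If `R(x) + y * x ^ (d - 1)` is a small perturbation of `v * x ^ d`, then reduction modulo `B(x)`
followed by division by `x ^ d` recovers `v`. -/
lemma emod_ediv_eq {d : ℕ} (hd : 1 ≤ d) {v x y L N β q : ℤ} (hv : 0 ≤ v) (hx : 0 < x)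
    (hN : N = q * β + (v * x ^ d + L)) (hL : |L| ≤ y * x ^ (d - 1)) (hy : 2 * y < x)
    (hβ : (v + 1) * x ^ d ≤ β) :
    (y * x ^ (d - 1) + N) % β / x ^ d = v := by
  have hxd : 0 < x ^ d := by positivity
  have hpow : x ^ d = x * x ^ (d - 1) := by rw [← pow_succ', Nat.sub_add_cancel hd]
  have hx1 : 0 < x ^ (d - 1) := by positivity
  obtain ⟨hL1, hL2⟩ := abs_le.mp hL
  have h0 : 0 ≤ y * x ^ (d - 1) + L := by linarith
  have h1 : y * x ^ (d - 1) + L < x ^ d := by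
    rw [hpow]
    nlinarith
  have hmod : (y * x ^ (d - 1) + N) % β = v * x ^ d + (y * x ^ (d - 1) + L) := by
    rw [show y * x ^ (d - 1) + N = v * x ^ d + (y * x ^ (d - 1) + L) + q * β by rw [hN]; ring,
      Int.add_mul_emod_self_right]
    exact Int.emod_eq_of_lt (by positivity) (by linarith)
  rw [hmod, add_comm, Int.add_mul_ediv_right _ _ hxd.ne', Int.ediv_eq_zero_of_lt h0 h1, zero_add]

/-- Growth estimate: `b ^ ⌈n / 2⌉` dominates `M * c ^ n` once `b ≥ (M * c) ^ 2`. -/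
lemma mul_pow_le_pow_half {M c b n : ℕ} (hM : 1 ≤ M) (hc : 1 ≤ c) (hb : (M * c) ^ 2 ≤ b)
    (hn : 1 ≤ n) : M * c ^ n ≤ b ^ ((n + 1) / 2) :=
  calc M * c ^ n ≤ M ^ n * c ^ n := by
        gcongr
        exact Nat.le_self_pow (by omega) M
    _ = (M * c) ^ n := (mul_pow _ _ _).symm
    _ ≤ (M * c) ^ (2 * ((n + 1) / 2)) :=
        Nat.pow_le_pow_right (Nat.mul_pos hM hc) (by omega)
    _ = ((M * c) ^ 2) ^ ((n + 1) / 2) := pow_mul _ _ _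
    _ ≤ b ^ ((n + 1) / 2) := Nat.pow_le_pow_left hb _

/-- Remainder-quotient representation for integer C-recursive sequences: with `c ≥ 1`
such that `|s n| < c^(n+1)` and `u n = s n + c^(n+1)` a sequence of natural numbers whose
recurrence polynomial is `B(X) = (X - c) · (X^d + α₁ X^(d-1) + ⋯ + α_d)`,
`U(X) = u d + u (d-1) X + ⋯ + u 0 X^d` and `A` the exact quotient of `B · U` by
`X^(d+1)`, there exist `b₀, n₀` such that for all `b ≥ b₀` and `n ≥ n₀`:
`s n = ⌊((b^(n(d-1)+⌈n/2⌉) + b^(n²) · A(b^n)) mod B(b^n)) / b^(nd)⌋ - c^(n+1)`. -/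
theorem stmt_10 (s : ℕ → ℤ) (d : ℕ) (hd : 2 ≤ d) (α : ℕ → ℤ) (hαd : α d ≠ 0)
    (hrec : ∀ n : ℕ, s (n + d) + ∑ i ∈ Finset.range d, α (i + 1) * s (n + (d - 1 - i)) = 0)
    (c : ℕ) (hc : 1 ≤ c) (hbound : ∀ n : ℕ, |s n| < (c : ℤ) ^ (n + 1))
    (u : ℕ → ℤ) (hu : ∀ n : ℕ, u n = s n + (c : ℤ) ^ (n + 1)) (hupos : ∀ n : ℕ, 0 ≤ u n)
    (B : ℤ[X]) (hB : B = (X - Polynomial.C (c : ℤ)) *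
      (X ^ d + ∑ i ∈ Finset.range d, Polynomial.C (α (i + 1)) * X ^ (d - 1 - i)))
    (U : ℤ[X]) (hU : U = ∑ j ∈ Finset.range (d + 1), Polynomial.C (u (d - j)) * X ^ j)
    (A : ℤ[X]) (hA : B * U = (B * U) %ₘ X ^ (d + 1) + X ^ (d + 1) * A) :
    ∃ b₀ n₀ : ℕ, ∀ b : ℕ, b₀ ≤ b → ∀ n : ℕ, n₀ ≤ n →
      s n =
        ((b : ℤ) ^ (n * (d - 1) + (n + 1) / 2) + (b : ℤ) ^ (n ^ 2) * A.eval ((b : ℤ) ^ n))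
          % B.eval ((b : ℤ) ^ n) / (b : ℤ) ^ (n * d) - (c : ℤ) ^ (n + 1) := by
  set P : ℤ[X] := X ^ d + ∑ i ∈ Finset.range d, C (α (i + 1)) * X ^ (d - 1 - i) with hP
  have hlt := degree_sum_descending_lt (by omega : 0 < d) α
  have hPm : P.Monic := monic_X_pow_add hlt
  have hPd : P.natDegree = d := by
    apply natDegree_eq_of_degree_eq_some
    rw [hP, degree_add_eq_left_of_degree_lt (by rwa [degree_X_pow]), degree_X_pow]
  have hBm : B.Monic := hB ▸ (monic_X_sub_C _).mul hPm
  have hBd : B.natDegree = d + 1 := by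
    rw [hB, (monic_X_sub_C _).natDegree_mul hPm, natDegree_X_sub_C, hPd, add_comm]
  have hPs : aeval shiftMap P s = 0 := by
    funext n
    rw [hP, map_add, map_sum, LinearMap.add_apply, LinearMap.sum_apply, Pi.add_apply,
      Finset.sum_apply]
    simpa [shiftMap_pow_apply] using hrec n
  have hBu : aeval shiftMap B u = 0 := hB ▸ aeval_shiftMap_mul_eq_zero hPs hu
  have hurec : ∀ n, ∑ k ∈ Finset.range (d + 2), B.coeff k * u (n + k) = 0 := fun n => by
    rw [← aeval_shiftMap_apply B u n (by omega), hBu, Pi.zero_apply]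
  have hAc := coeff_of_eq_modByMonic_add hU hA
  obtain ⟨K, hK1, hK⟩ := exists_abs_coeff_le B
  have hc' : (1 : ℤ) ≤ c := by exact_mod_cast hc
  have hu_lt : ∀ n, u n + 1 ≤ 2 * (c : ℤ) ^ (n + 1) := fun n => by
    have := (abs_lt.mp (hbound n)).2
    rw [hu]
    omega
  set M : ℕ := d * ((d + 1) * (K * (2 * c ^ (d + 1)))) with hM
  have hM1 : 1 ≤ M := by
    have : 0 < c := hc
    have : 0 < d := by omega
    rw [hM]
    exact Nat.succ_le_of_lt (by positivity)
  refine ⟨(M * c) ^ 2 + 3, 3, fun b hb n hn => ?_⟩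
  obtain ⟨Q, R, hQR, hR⟩ := exists_X_pow_mul_eq hBd hurec hAc n
  set x : ℤ := (b : ℤ) ^ n with hx
  set y : ℤ := (b : ℤ) ^ ((n + 1) / 2) with hy
  have hb3 : (3 : ℤ) ≤ b := by exact_mod_cast (by omega : 3 ≤ b)
  have hx1 : 1 ≤ x := one_le_pow₀ (by linarith)
  have hMy : (M : ℤ) * c ^ n ≤ y := by
    rw [hy]
    exact_mod_cast mul_pow_le_pow_half hM1 hc (by omega : (M * c) ^ 2 ≤ b) (by omega : 1 ≤ n)
  have hyx : 2 * y < x := by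
    have hy0 : 0 < y := by positivity
    calc 2 * y < b * y := by nlinarith
      _ = (b : ℤ) ^ ((n + 1) / 2 + 1) := by rw [pow_succ', hy]
      _ ≤ x := pow_le_pow_right₀ (by linarith) (by omega)
  set W : ℤ := (d + 1) * (K * (2 * c ^ (d + 1) * c ^ n)) with hW
  have hdW : (d : ℤ) * W = M * c ^ n := by
    rw [hW, hM]
    push_cast
    ring
  have hRW : ∀ j, |R.coeff j| ≤ W := fun j => by
    rw [hR]
    refine (Finset.abs_sum_le_sum_abs _ _).trans ?_
    have hterm : ∀ k ∈ Finset.range (d + 1),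
        |B.coeff (j + 1 + k) * u (n + k)| ≤ K * (2 * c ^ (d + 1) * c ^ n) := fun k hk => by
      have hk' : k < d + 1 := Finset.mem_range.mp hk
      rw [abs_mul, abs_of_nonneg (hupos _)]
      have h1 : u (n + k) ≤ 2 * (c : ℤ) ^ (d + 1) * c ^ n := by
        have h2 : (c : ℤ) ^ (n + k + 1) ≤ c ^ (d + 1 + n) := pow_le_pow_right₀ hc' (by omega)
        have := hu_lt (n + k)
        rw [mul_assoc, ← pow_add]
        linarith
      exact mul_le_mul (hK _) h1 (hupos _) (by positivity)
    refine (Finset.sum_le_card_nsmul _ _ _ hterm).trans_eq ?_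
    simp [hW]
  have hRd : R.natDegree < d + 1 := by
    rw [Nat.lt_succ_iff, natDegree_le_iff_coeff_eq_zero]
    intro j hj
    rw [hR]
    refine Finset.sum_eq_zero fun k _ => ?_
    rw [coeff_eq_zero_of_natDegree_lt (by omega), zero_mul]
  have hRtop : R.coeff d = u n := by
    rw [hR, Finset.sum_eq_single_of_mem 0 (by simp)]
    · have h := hBm.coeff_natDegree
      rw [hBd] at h
      simp [h]
    · intro k _ hk
      rw [coeff_eq_zero_of_natDegree_lt (by omega), zero_mul]
  have hReval : R.eval x = u n * x ^ d + ∑ j ∈ Finset.range d, R.coeff j * x ^ j := by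
    rw [eval_eq_sum_range' hRd, Finset.sum_range_succ, hRtop, add_comm]
  have hBeval : B.eval x = x ^ (d + 1) + ∑ j ∈ Finset.range (d + 1), B.coeff j * x ^ j := by
    have h := hBm.coeff_natDegree
    rw [hBd] at h
    rw [eval_eq_sum_range, hBd, Finset.sum_range_succ, h, one_mul, add_comm]
  have hL : |∑ j ∈ Finset.range d, R.coeff j * x ^ j| ≤ y * x ^ (d - 1) :=
    (abs_sum_mul_pow_le hx1 hRW).trans (by rw [hdW]; gcongr)
  have hβ : (u n + 1) * x ^ d ≤ B.eval x := by
    have hlow := (abs_le.mp (abs_sum_mul_pow_le (m := d + 1) hx1 hK)).1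
    rw [Nat.add_sub_cancel] at hlow
    push_cast at hlow
    have hd' : (1 : ℤ) ≤ d := by exact_mod_cast (by omega : 1 ≤ d)
    have hK' : (1 : ℤ) ≤ K := by exact_mod_cast hK1
    have hcd : (1 : ℤ) ≤ c ^ d := one_le_pow₀ hc'
    have hcn : (1 : ℤ) ≤ c ^ (n + 1) := one_le_pow₀ hc'
    have hMe : (M : ℤ) * c ^ n = (d * (d + 1) * K) * c ^ d * (2 * c ^ (n + 1)) := by
      rw [hM]
      push_cast
      ring
    have hcoef : (1 : ℤ) ≤ d * (d + 1) * K :=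
      one_le_mul_of_one_le_of_one_le (one_le_mul_of_one_le_of_one_le hd' (by linarith)) hK'
    have h1 : 2 * (c : ℤ) ^ (n + 1) ≤ y := by
      refine le_trans ?_ hMy
      rw [hMe]
      exact le_mul_of_one_le_left (by positivity) (one_le_mul_of_one_le_of_one_le hcoef hcd)
    have h2 : ((d : ℤ) + 1) * K ≤ y := by
      refine le_trans ?_ hMy
      rw [hMe]
      calc ((d : ℤ) + 1) * K ≤ d * ((d + 1) * K) := le_mul_of_one_le_left (by positivity) hd'
        _ = d * (d + 1) * K := by ring
        _ ≤ d * (d + 1) * K * (c ^ d * (2 * c ^ (n + 1))) :=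
            le_mul_of_one_le_right (by positivity)
              (one_le_mul_of_one_le_of_one_le hcd (by linarith))
        _ = _ := by ring
    have hsum : u n + 1 + (d + 1) * K ≤ x := by linarith [hu_lt n]
    have hmul := mul_le_mul_of_nonneg_right hsum (by positivity : 0 ≤ x ^ d)
    rw [hBeval, pow_succ']
    linarith
  have hN : (b : ℤ) ^ (n ^ 2) * A.eval x = Q.eval x * B.eval x +
      (u n * x ^ d + ∑ j ∈ Finset.range d, R.coeff j * x ^ j) := by
    have h := congrArg (eval x) hQR
    simp only [eval_mul, eval_add, eval_pow, eval_X] at h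
    rw [sq, pow_mul, ← hx, h, hReval]
    ring
  have key := emod_ediv_eq (by omega : 1 ≤ d) (hupos n) (by linarith) hN hL hyx hβ
  rw [pow_add, pow_mul, pow_mul, ← hx, ← hy, mul_comm (x ^ (d - 1)), key, hu]
  ring
end

section
/- Let s : ℕ → ℤ be a C-recursive sequence of degree d ≥ 2 with integer coefficients α₁, …, α_d (α_d ≠ 0), and let c ≥ 1 be a natural number such that |s(n)| < c^{n+1} for all n ≥ 0 and such that u(n) = s(n) + c^{n+1} is a C-recursive sequence of natural numbers of degree d+1 whose recurrence polynomial is B(X) = (X − c)·(X^d + α₁X^{d−1} + ⋯ + α_d), with free term γ_{d+1} = B(0) = −c·α_d. Let U_d(X) = u(d) + u(d−1)X + ⋯ + u(0)X^d and let A(X) ∈ ℤ[X] be the exact polynomial quotient of B(X)·U_d(X) by X^{d+1}. Then there exist natural numbers b₀ and n₀ such that for every b ≥ b₀ and every n ≥ n₀: |γ_{d+1}|·(s(n) + c^{n+1}) = ((b^{nd+⌈n/2⌉} − sgn(γ_{d+1})·b^{n(n+1)}·A(b^n)) mod B(b^n)) mod b^n. -/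
open Polynomial

theorem coeff_iterate_divX (p : ℤ[X]) (k n : ℕ) : (divX^[k] p).coeff n = p.coeff (n + k) := by
  induction k generalizing n with
  | zero => simp
  | succ k ih => rw [Function.iterate_succ_apply', coeff_divX, ih]; congr 1; ring

theorem X_mul_iterate_divX_succ (p : ℤ[X]) (k : ℕ) :
    X * divX^[k + 1] p = divX^[k] p - C (p.coeff k) := by
  have h := X_mul_divX_add (divX^[k] p)
  rw [coeff_iterate_divX, zero_add] at h
  rw [Function.iterate_succ_apply']
  linear_combination h

/-- The shift operator on integer sequences. -/
def seqShift : Module.End ℤ (ℕ → ℤ) := LinearMap.funLeft ℤ ℤ (· + 1)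

theorem seqShift_pow_apply (k : ℕ) (v : ℕ → ℤ) (n : ℕ) : (seqShift ^ k) v n = v (n + k) := by
  induction k generalizing n with
  | zero => simp
  | succ k ih =>
    rw [pow_succ', Module.End.mul_apply]
    change (seqShift ^ k) v (n + 1) = _
    rw [ih]; congr 1; ring

theorem aeval_seqShift_apply (p : ℤ[X]) {N : ℕ} (hN : p.natDegree < N) (v : ℕ → ℤ) (n : ℕ) :
    aeval seqShift p v n = ∑ i ∈ Finset.range N, p.coeff i * v (n + i) := by
  rw [aeval_eq_sum_range' hN]
  simp [seqShift_pow_apply, LinearMap.sum_apply, Finset.sum_apply]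

/-- The polynomial part of `B(X) · ∑ u (n + m) X^(-m-1)`. -/
noncomputable def recTail (B : ℤ[X]) (u : ℕ → ℤ) (d n : ℕ) : ℤ[X] :=
  ∑ m ∈ Finset.range (d + 1), C (u (n + m)) * divX^[m + 1] B

theorem X_mul_recTail {B : ℤ[X]} {d : ℕ} (hB : B.Monic) (hd : B.natDegree = d + 1)
    {u : ℕ → ℤ} (hu : aeval seqShift B u = 0) (n : ℕ) :
    X * recTail B u d n = C (u n) * B + recTail B u d (n + 1) := by
  have hrec := congrFun hu n
  rw [aeval_seqShift_apply B (N := d + 2) (by omega), Pi.zero_apply] at hrec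
  have hone : divX^[d + 1] B = 1 := by
    ext k
    rw [coeff_iterate_divX, coeff_one]
    split_ifs with h
    · subst h; rw [zero_add, ← hd]; exact hB
    · exact coeff_eq_zero_of_natDegree_lt (by omega)
  have hcoeff : B.coeff (d + 1) = 1 := by rw [← hd]; exact hB
  have hrec' := congrArg (C : ℤ →+* ℤ[X]) hrec
  rw [Finset.sum_range_succ, hcoeff, map_add, map_sum, map_zero, one_mul] at hrec'
  have hl : X * recTail B u d n = ∑ m ∈ Finset.range (d + 1), C (u (n + m)) * divX^[m] B
      - ∑ m ∈ Finset.range (d + 1), C (B.coeff m * u (n + m)) := by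
    rw [recTail, Finset.mul_sum, ← Finset.sum_sub_distrib]
    refine Finset.sum_congr rfl fun m _ => ?_
    rw [mul_left_comm, X_mul_iterate_divX_succ, C_mul]
    ring
  have hr : C (u n) * B + recTail B u d (n + 1)
      = ∑ m ∈ Finset.range (d + 2), C (u (n + m)) * divX^[m] B := by
    rw [Finset.sum_range_succ', recTail, add_comm]
    simp [add_assoc, add_comm 1]
  rw [hl, hr, Finset.sum_range_succ _ (d + 1), hone, mul_one]
  linear_combination -hrec'

theorem dvd_X_pow_mul_recTail_sub {B : ℤ[X]} {d : ℕ} (hB : B.Monic) (hd : B.natDegree = d + 1)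
    {u : ℕ → ℤ} (hu : aeval seqShift B u = 0) (n : ℕ) :
    B ∣ X ^ n * recTail B u d 0 - recTail B u d n := by
  induction n with
  | zero => simp
  | succ n ih =>
    have h : X ^ (n + 1) * recTail B u d 0 - recTail B u d (n + 1)
        = X * (X ^ n * recTail B u d 0 - recTail B u d n) + C (u n) * B := by
      linear_combination X_mul_recTail hB hd hu n
    rw [h]
    exact dvd_add (ih.mul_left _) (dvd_mul_left _ _)

theorem eval_zero_recTail_succ {B : ℤ[X]} {d : ℕ} (hB : B.Monic) (hd : B.natDegree = d + 1)
    {u : ℕ → ℤ} (hu : aeval seqShift B u = 0) (n : ℕ) :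
    (recTail B u d (n + 1)).eval 0 = -(B.eval 0 * u n) := by
  have h := congrArg (eval 0) (X_mul_recTail hB hd hu n)
  simp only [eval_mul, eval_X, zero_mul, eval_add, eval_C] at h
  linear_combination -h

theorem eq_recTail_zero {B A : ℤ[X]} {d : ℕ} (u : ℕ → ℤ)
    (hA : B * (∑ j ∈ Finset.range (d + 1), C (u (d - j)) * X ^ j)
      = (B * (∑ j ∈ Finset.range (d + 1), C (u (d - j)) * X ^ j)) %ₘ X ^ (d + 1)
        + X ^ (d + 1) * A) :
    A = recTail B u d 0 := by
  ext k
  have h := congrArg (fun p => coeff p (k + (d + 1))) hA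
  have hz : ((B * (∑ j ∈ Finset.range (d + 1), C (u (d - j)) * X ^ j)) %ₘ X ^ (d + 1)).coeff
      (k + (d + 1)) = 0 := by
    apply coeff_eq_zero_of_degree_lt
    refine (degree_modByMonic_lt _ (monic_X_pow _)).trans_le ?_
    rw [degree_X_pow]
    exact_mod_cast Nat.le_add_left _ _
  simp only [coeff_add, coeff_X_pow_mul, hz, zero_add] at h
  rw [← h, ← Finset.sum_range_reflect, Finset.mul_sum, finsetSum_coeff, recTail, finsetSum_coeff]
  refine Finset.sum_congr rfl fun m hm => ?_
  have hm' : m ≤ d := Nat.lt_succ_iff.1 (Finset.mem_range.1 hm)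
  have e1 : d + 1 - 1 - m = d - m := by omega
  have e2 : d - (d - m) = m := by omega
  have e3 : k + (d + 1) = (k + (m + 1)) + (d - m) := by omega
  rw [e1, e2, e3, mul_left_comm, coeff_C_mul, coeff_mul_X_pow, coeff_C_mul, coeff_iterate_divX,
    zero_add]

theorem abs_eval_le (p : ℤ[X]) {d : ℕ} (hp : p.natDegree ≤ d) {x : ℤ} (hx : 1 ≤ x) :
    |p.eval x| ≤ (∑ i ∈ Finset.range (d + 1), |p.coeff i|) * x ^ d := by
  rw [eval_eq_sum_range' (Nat.lt_succ_of_le hp), Finset.sum_mul]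
  refine (Finset.abs_sum_le_sum_abs _ _).trans (Finset.sum_le_sum fun i hi => ?_)
  rw [abs_mul, abs_of_nonneg (pow_nonneg (zero_le_one.trans hx) i)]
  exact mul_le_mul_of_nonneg_left
    (pow_le_pow_right₀ hx (Nat.lt_succ_iff.1 (Finset.mem_range.1 hi))) (abs_nonneg _)

theorem exists_abs_eval_recTail_le {B : ℤ[X]} {d : ℕ} (hd : B.natDegree = d + 1)
    {u : ℕ → ℤ} {c a : ℤ} (hc : 1 ≤ c) (ha : 0 ≤ a) (hu : ∀ n, |u n| ≤ a * c ^ n) :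
    ∃ K : ℤ, 0 ≤ K ∧ ∀ n : ℕ, ∀ x : ℤ, 1 ≤ x →
      |(recTail B u d n).eval x| ≤ K * c ^ n * x ^ d := by
  have hc0 : (0 : ℤ) ≤ c := by omega
  refine ⟨∑ m ∈ Finset.range (d + 1),
    a * c ^ m * ∑ i ∈ Finset.range (d + 1), |(divX^[m + 1] B).coeff i|,
    Finset.sum_nonneg fun m _ => by positivity, fun n x hx => ?_⟩
  rw [recTail, eval_finsetSum, Finset.sum_mul, Finset.sum_mul]
  refine (Finset.abs_sum_le_sum_abs _ _).trans (Finset.sum_le_sum fun m _ => ?_)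
  have hdeg : (divX^[m + 1] B).natDegree ≤ d := by
    rw [natDegree_le_iff_coeff_eq_zero]
    intro k hk
    rw [coeff_iterate_divX]
    exact coeff_eq_zero_of_natDegree_lt (by omega)
  rw [eval_mul, eval_C, abs_mul]
  calc _ ≤ (a * c ^ (n + m)) * _ :=
        mul_le_mul (hu _) (abs_eval_le _ hdeg hx) (abs_nonneg _) (by positivity)
    _ = _ := by rw [pow_add]; ring

theorem exists_le_eval_monic {B : ℤ[X]} {d : ℕ} (hB : B.Monic) (hd : B.natDegree = d + 1) :
    ∃ L : ℤ, 0 ≤ L ∧ ∀ x : ℤ, 1 ≤ x → (x - L) * x ^ d ≤ B.eval x := by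
  refine ⟨∑ i ∈ Finset.range (d + 1), |B.coeff i|,
    Finset.sum_nonneg fun i _ => abs_nonneg _, fun x hx => ?_⟩
  have hcoeff : B.coeff (d + 1) = 1 := by rw [← hd]; exact hB
  rw [eval_eq_sum_range' (n := d + 2) (by omega), Finset.sum_range_succ _ (d + 1), hcoeff]
  have h : -∑ i ∈ Finset.range (d + 1), B.coeff i * x ^ i
      ≤ (∑ i ∈ Finset.range (d + 1), |B.coeff i|) * x ^ d := by
    rw [Finset.sum_mul, ← Finset.sum_neg_distrib]
    refine Finset.sum_le_sum fun i hi => ?_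
    refine (neg_le_abs _).trans ?_
    rw [abs_mul, abs_of_nonneg (pow_nonneg (zero_le_one.trans hx) i)]
    exact mul_le_mul_of_nonneg_left
      (pow_le_pow_right₀ hx (Nat.lt_succ_iff.1 (Finset.mem_range.1 hi))) (abs_nonneg _)
  linear_combination h

theorem natDegree_and_monic_X_pow_add_sum (d : ℕ) (α : ℕ → ℤ) :
    (X ^ d + ∑ i ∈ Finset.range d, C (α (i + 1)) * X ^ (d - 1 - i)).natDegree = d ∧
      (X ^ d + ∑ i ∈ Finset.range d, C (α (i + 1)) * X ^ (d - 1 - i)).Monic := by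
  have h : (∑ i ∈ Finset.range d, C (α (i + 1)) * X ^ (d - 1 - i)).degree < (d : WithBot ℕ) := by
    rw [← mem_degreeLT]
    refine Submodule.sum_mem _ fun i hi => mem_degreeLT.2 ?_
    refine (degree_C_mul_X_pow_le _ _).trans_lt ?_
    have := Finset.mem_range.1 hi
    exact_mod_cast (by omega : d - 1 - i < d)
  refine ⟨?_, monic_X_pow_add h⟩
  apply natDegree_eq_of_degree_eq_some
  rw [degree_add_eq_left_of_degree_lt (by rwa [degree_X_pow]), degree_X_pow]

theorem aeval_seqShift_X_sub_C_mul {P : ℤ[X]} {s u : ℕ → ℤ} {c : ℤ}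
    (hs : aeval seqShift P s = 0) (hu : ∀ n, u n = s n + c ^ (n + 1)) :
    aeval seqShift ((X - C c) * P) u = 0 := by
  have hu' : u = s + fun n => c ^ (n + 1) := funext hu
  have hgeo : aeval seqShift (X - C c) (fun n : ℕ => c ^ (n + 1)) = 0 := by
    funext n
    rw [aeval_seqShift_apply (N := 2) _ (by rw [natDegree_X_sub_C]; omega)]
    simp only [Finset.sum_range_succ, coeff_sub, coeff_X, coeff_C]
    simp
    ring
  rw [hu', map_add]
  nth_rewrite 2 [mul_comm]
  rw [map_mul, map_mul, Module.End.mul_apply, Module.End.mul_apply, hs, hgeo, map_zero, map_zero,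
    add_zero]

theorem aeval_seqShift_eq_zero_of_rec {s : ℕ → ℤ} {d : ℕ} {α : ℕ → ℤ}
    (hrec : ∀ n : ℕ, s (n + d) + ∑ i ∈ Finset.range d, α (i + 1) * s (n + (d - 1 - i)) = 0) :
    aeval seqShift (X ^ d + ∑ i ∈ Finset.range d, C (α (i + 1)) * X ^ (d - 1 - i)) s = 0 := by
  funext n
  rw [Pi.zero_apply, ← hrec n]
  simp [seqShift_pow_apply, LinearMap.sum_apply, Finset.sum_apply]

/-- The size estimates which make both remainders in the representation exact. -/
theorem pow_half_bounds {c b n : ℕ} {K : ℤ} (hc : 1 ≤ c) (hK : 3 ≤ K)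
    (hb : ((c : ℤ) * K) ^ 2 ≤ b) (hn : 2 ≤ n) :
    K * (c : ℤ) ^ n ≤ (b : ℤ) ^ ((n + 1) / 2) ∧
      K * (b : ℤ) ^ ((n + 1) / 2) ≤ (b : ℤ) ^ n := by
  have hc' : (1 : ℤ) ≤ c := by exact_mod_cast hc
  have hM : 1 ≤ (c : ℤ) * K := by nlinarith
  have hKM : K ≤ (c : ℤ) * K := by nlinarith
  constructor
  · calc K * (c : ℤ) ^ n ≤ K ^ n * (c : ℤ) ^ n :=
          mul_le_mul_of_nonneg_right (le_self_pow₀ (by omega) (by omega)) (by positivity)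
      _ = ((c : ℤ) * K) ^ n := by rw [mul_pow, mul_comm]
      _ ≤ ((c : ℤ) * K) ^ (2 * ((n + 1) / 2)) := pow_le_pow_right₀ hM (by omega)
      _ = (((c : ℤ) * K) ^ 2) ^ ((n + 1) / 2) := pow_mul _ _ _
      _ ≤ _ := pow_le_pow_left₀ (by positivity) hb _
  · have hbK : K ≤ (b : ℤ) := by nlinarith
    calc K * (b : ℤ) ^ ((n + 1) / 2) ≤ (b : ℤ) * (b : ℤ) ^ ((n + 1) / 2) :=
          mul_le_mul_of_nonneg_right hbK (by positivity)
      _ = (b : ℤ) ^ ((n + 1) / 2 + 1) := (pow_succ' _ _).symm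
      _ ≤ _ := pow_le_pow_right₀ (by omega) (by omega)

theorem emod_emod_eq_of_dvd {N M x V w : ℤ} (hNV : M ∣ N - V) (h0 : 0 ≤ V) (hV : V < M)
    (hVw : x ∣ V - w) (hw0 : 0 ≤ w) (hw : w < x) : w = N % M % x := by
  rw [Int.emod_eq_emod_iff_emod_sub_eq_zero.2 (Int.emod_eq_zero_of_dvd hNV),
    Int.emod_eq_of_lt h0 hV, Int.emod_eq_emod_iff_emod_sub_eq_zero.2 (Int.emod_eq_zero_of_dvd hVw),
    Int.emod_eq_of_lt hw0 hw]


/-- Remainder-remainder representation for integer C-recursive sequences: with `c ≥ 1`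
such that `|s n| < c^(n+1)` and `u n = s n + c^(n+1)` a sequence of natural numbers whose
recurrence polynomial is `B(X) = (X - c) · (X^d + α₁ X^(d-1) + ⋯ + α_d)` with free term
`γ = B(0) = -c · α_d`, `U(X) = u d + u (d-1) X + ⋯ + u 0 X^d` and `A` the exact quotient
of `B · U` by `X^(d+1)`, there exist `b₀, n₀` such that for all `b ≥ b₀` and `n ≥ n₀`:
`|γ| · (s n + c^(n+1)) = ((b^(nd+⌈n/2⌉) - sgn(γ) · b^(n(n+1)) · A(b^n)) mod B(b^n)) mod b^n`. -/
theorem stmt_11 (s : ℕ → ℤ) (d : ℕ) (hd : 2 ≤ d) (α : ℕ → ℤ) (hαd : α d ≠ 0)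
    (hrec : ∀ n : ℕ, s (n + d) + ∑ i ∈ Finset.range d, α (i + 1) * s (n + (d - 1 - i)) = 0)
    (c : ℕ) (hc : 1 ≤ c) (hbound : ∀ n : ℕ, |s n| < (c : ℤ) ^ (n + 1))
    (u : ℕ → ℤ) (hu : ∀ n : ℕ, u n = s n + (c : ℤ) ^ (n + 1)) (hupos : ∀ n : ℕ, 0 ≤ u n)
    (B : ℤ[X]) (hB : B = (X - Polynomial.C (c : ℤ)) *
      (X ^ d + ∑ i ∈ Finset.range d, Polynomial.C (α (i + 1)) * X ^ (d - 1 - i)))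
    (γ : ℤ) (hγ : γ = -(c : ℤ) * α d)
    (U : ℤ[X]) (hU : U = ∑ j ∈ Finset.range (d + 1), Polynomial.C (u (d - j)) * X ^ j)
    (A : ℤ[X]) (hA : B * U = (B * U) %ₘ X ^ (d + 1) + X ^ (d + 1) * A) :
    ∃ b₀ n₀ : ℕ, ∀ b : ℕ, b₀ ≤ b → ∀ n : ℕ, n₀ ≤ n →
      |γ| * (s n + (c : ℤ) ^ (n + 1)) =
        ((b : ℤ) ^ (n * d + (n + 1) / 2)
            - Int.sign γ * (b : ℤ) ^ (n * (n + 1)) * A.eval ((b : ℤ) ^ n))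
          % B.eval ((b : ℤ) ^ n) % (b : ℤ) ^ n := by
  obtain ⟨hPdeg, hPmonic⟩ := natDegree_and_monic_X_pow_add_sum d α
  have hBmonic : B.Monic := hB ▸ (monic_X_sub_C _).mul hPmonic
  have hBdeg : B.natDegree = d + 1 := by
    rw [hB, (monic_X_sub_C _).natDegree_mul hPmonic, natDegree_X_sub_C, hPdeg, add_comm]
  have hBu : aeval seqShift B u = 0 :=
    hB ▸ aeval_seqShift_X_sub_C_mul (aeval_seqShift_eq_zero_of_rec hrec) hu
  have hB0 : B.eval 0 = γ := by
    rw [hB, hγ, eval_mul, eval_add, eval_finsetSum, Finset.sum_eq_single (d - 1)]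
    · simp [show d - 1 + 1 = d by omega, show d ≠ 0 by omega]
    · intro i hi hne
      have := Finset.mem_range.1 hi
      simp [show d - 1 - i ≠ 0 by omega]
    · intro h
      exact absurd (Finset.mem_range.2 (by omega)) h
  have hAT : A = recTail B u d 0 := eq_recTail_zero u (hU ▸ hA)
  have hc' : (1 : ℤ) ≤ c := by exact_mod_cast hc
  have hulb : ∀ n, u n ≤ 2 * c * (c : ℤ) ^ n := fun n => by
    have := (abs_lt.1 (hbound n)).2
    rw [hu n, pow_succ] at *
    linarith
  obtain ⟨K, hK0, hK⟩ := exists_abs_eval_recTail_le (B := B) (u := u) (a := 2 * c) hBdeg hc'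
    (by positivity) (fun n => (abs_of_nonneg (hupos n)).trans_le (hulb n))
  obtain ⟨L, hL0, hL⟩ := exists_le_eval_monic hBmonic hBdeg
  set M : ℤ := K * c + L + |γ| * (2 * c) + 3 with hM
  have hKc : 0 ≤ K * (c : ℤ) := by positivity
  have hγc : 0 ≤ |γ| * (2 * (c : ℤ)) := by positivity
  refine ⟨((c * M) ^ 2).toNat, 2, fun b hb n hn => ?_⟩
  obtain ⟨h1, h2⟩ := pow_half_bounds (K := M) hc (by omega) (Int.toNat_le.1 hb) hn
  rw [← hu n]
  have hcn : (0 : ℤ) < (c : ℤ) ^ n := by positivity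
  have hexp1 : (b : ℤ) ^ (n * d + (n + 1) / 2) = ((b : ℤ) ^ n) ^ d * (b : ℤ) ^ ((n + 1) / 2) := by
    rw [pow_add, pow_mul]
  rw [hexp1, pow_mul]
  set q : ℤ := (b : ℤ) ^ ((n + 1) / 2)
  set x : ℤ := (b : ℤ) ^ n
  have hq : 1 ≤ q := by nlinarith
  have hxq : (L + 3) * q ≤ x :=
    (mul_le_mul_of_nonneg_right (by omega) (by omega)).trans h2
  have hqx : 3 * q ≤ x :=
    (mul_le_mul_of_nonneg_right (by omega) (by omega)).trans hxq
  have hx : 1 ≤ x := by omega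
  have hxd : 0 < x ^ d := by positivity
  have hT : |(recTail B u d (n + 1)).eval x| ≤ q * x ^ d := by
    refine (hK (n + 1) x hx).trans (mul_le_mul_of_nonneg_right (le_trans ?_ h1) hxd.le)
    rw [pow_succ, ← mul_assoc, mul_right_comm]
    exact mul_le_mul_of_nonneg_right (by omega) hcn.le
  have hsT : |Int.sign γ * (recTail B u d (n + 1)).eval x| ≤ q * x ^ d := by
    rw [abs_mul]
    refine le_trans (mul_le_of_le_one_left (abs_nonneg _) ?_) hT
    rcases lt_trichotomy γ 0 with h | h | h
    · simp [Int.sign_eq_neg_one_of_neg h]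
    · simp [h]
    · simp [Int.sign_eq_one_of_pos h]
  obtain ⟨hlo, hhi⟩ := abs_le.1 hsT
  refine emod_emod_eq_of_dvd
    (V := x ^ d * q - Int.sign γ * (recTail B u d (n + 1)).eval x) ?_ ?_ ?_ ?_ ?_ ?_
  · have h := eval_dvd (x := x) (dvd_X_pow_mul_recTail_sub hBmonic hBdeg hBu (n + 1))
    rw [← hAT, eval_sub, eval_mul, eval_pow, eval_X] at h
    have hN : x ^ d * q - Int.sign γ * x ^ (n + 1) * A.eval x
        - (x ^ d * q - Int.sign γ * (recTail B u d (n + 1)).eval x)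
        = -Int.sign γ * (x ^ (n + 1) * A.eval x - (recTail B u d (n + 1)).eval x) := by
      ring
    rw [hN]
    exact h.mul_left _
  · linarith
  · refine lt_of_lt_of_le ?_ (hL x hx)
    have hLq : L ≤ L * q := le_mul_of_one_le_right hL0 hq
    have h3 : 2 * q < x - L := by linarith
    have h4 := mul_lt_mul_of_pos_right h3 hxd
    linarith
  · have h := sub_dvd_eval_sub x 0 (recTail B u d (n + 1))
    rw [eval_zero_recTail_succ hBmonic hBdeg hBu, hB0, sub_zero] at h
    have hV : x ^ d * q - Int.sign γ * (recTail B u d (n + 1)).eval x - |γ| * u n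
        = x ^ d * q - Int.sign γ * ((recTail B u d (n + 1)).eval x - -(γ * u n)) := by
      rw [← Int.sign_mul_self_eq_abs]
      ring
    rw [hV]
    exact dvd_sub ((dvd_pow_self x (by omega)).mul_right _) (h.mul_left _)
  · exact mul_nonneg (abs_nonneg _) (hupos n)
  · have h3 : |γ| * u n ≤ |γ| * (2 * c) * (c : ℤ) ^ n := by
      rw [mul_assoc]
      exact mul_le_mul_of_nonneg_left (hulb n) (abs_nonneg _)
    have h4 : |γ| * (2 * c) * (c : ℤ) ^ n ≤ M * (c : ℤ) ^ n :=
      mul_le_mul_of_nonneg_right (by omega) hcn.le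
    linarith
end

section
/- Let s : ℕ → ℕ be a sequence satisfying s(n+2) + α₁·s(n+1) + α₂·s(n) = 0 for all n ≥ 0, with integer coefficients α₁, α₂ and α₂ < 0. Let B(X) = X² + α₁X + α₂ and A(X) = s(0)·X + (α₁·s(0) + s(1)). Then there exist natural numbers b₀ and n₀ such that for every b ≥ b₀ and every n ≥ n₀: s(n) = ⌊((b^{n²}·A(b^n)) mod B(b^n)) / b^n⌋. -/
/-- Polynomial division of `X ^ n * A(X)` by `B(X)` has remainder
`s n * X + (α₁ * s n + s (n + 1))`. -/
theorem modEq_pow_mul_of_linear_recurrence (s : ℕ → ℤ) (α₁ α₂ x : ℤ)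
    (hrec : ∀ n : ℕ, s (n + 2) + α₁ * s (n + 1) + α₂ * s n = 0) (n : ℕ) :
    x ^ n * (s 0 * x + (α₁ * s 0 + s 1)) ≡ s n * x + (α₁ * s n + s (n + 1))
      [ZMOD x ^ 2 + α₁ * x + α₂] := by
  induction n with
  | zero => simp [Int.ModEq]
  | succ n ih =>
    have h := ih.mul_left x
    rw [← mul_assoc, ← pow_succ'] at h
    refine h.trans (Int.modEq_iff_dvd.mpr ⟨-s n, ?_⟩)
    linear_combination hrec n

/-- A sequence satisfying a linear recurrence of order two grows at most exponentially. -/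
theorem le_pow_of_linear_recurrence (s : ℕ → ℕ) (α₁ α₂ K : ℤ)
    (hrec : ∀ n : ℕ, (s (n + 2) : ℤ) + α₁ * (s (n + 1) : ℤ) + α₂ * (s n : ℤ) = 0)
    (hK : |α₁| + |α₂| + s 0 + s 1 + 1 ≤ K) (n : ℕ) :
    (s n : ℤ) ≤ K ^ (n + 1) := by
  have h₁ := abs_nonneg α₁
  have h₂ := abs_nonneg α₂
  have hK1 : 1 ≤ K := by omega
  induction n using Nat.twoStepInduction with
  | zero => rw [zero_add, pow_one]; omega
  | one => exact le_trans (by omega) (le_self_pow₀ hK1 (by omega : 1 + 1 ≠ 0))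
  | more n ih₀ ih₁ =>
    have hmono : K ^ (n + 1) ≤ K ^ (n + 1 + 1) := pow_le_pow_right₀ hK1 (Nat.le_succ _)
    have hpos : 0 ≤ K ^ (n + 1 + 1) := by positivity
    calc (s (n + 2) : ℤ) = -α₁ * s (n + 1) + -α₂ * s n := by linear_combination hrec n
      _ ≤ |α₁| * K ^ (n + 1 + 1) + |α₂| * K ^ (n + 1 + 1) := by
        gcongr
        · exact neg_le_abs α₁
        · exact neg_le_abs α₂
        · exact ih₀.trans hmono
      _ = (|α₁| + |α₂|) * K ^ (n + 1 + 1) := by ring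
      _ ≤ K * K ^ (n + 1 + 1) := by gcongr; omega
      _ = K ^ (n + 2 + 1) := by ring

/-- Degree 2, negative free coefficient, remainder-quotient representation:
if `s (n+2) + α₁ · s (n+1) + α₂ · s n = 0` with `α₂ < 0`, `B(X) = X² + α₁ X + α₂` and
`A(X) = s 0 · X + (α₁ · s 0 + s 1)`, then there exist `b₀, n₀` such that for all
`b ≥ b₀` and `n ≥ n₀`: `s n = ⌊((b^(n²) · A(b^n)) mod B(b^n)) / b^n⌋`. -/
theorem stmt_12 (s : ℕ → ℕ) (α₁ α₂ : ℤ) (hα₂ : α₂ < 0)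
    (hrec : ∀ n : ℕ, (s (n + 2) : ℤ) + α₁ * (s (n + 1) : ℤ) + α₂ * (s n : ℤ) = 0) :
    ∃ b₀ n₀ : ℕ, ∀ b : ℕ, b₀ ≤ b → ∀ n : ℕ, n₀ ≤ n →
      (s n : ℤ) =
        ((b : ℤ) ^ (n ^ 2) * ((s 0 : ℤ) * (b : ℤ) ^ n + (α₁ * (s 0 : ℤ) + (s 1 : ℤ))))
          % (((b : ℤ) ^ n) ^ 2 + α₁ * (b : ℤ) ^ n + α₂) / (b : ℤ) ^ n := by
  obtain ⟨K, hK⟩ : ∃ K : ℕ, (K : ℤ) = |α₁| + |α₂| + s 0 + s 1 + 1 :=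
    ⟨(|α₁| + |α₂| + s 0 + s 1 + 1).toNat, Int.toNat_of_nonneg (by positivity)⟩
  have hK1 : (1 : ℤ) ≤ K := by
    have h₁ := abs_nonneg α₁
    have h₂ := abs_nonneg α₂
    omega
  refine ⟨2 * K ^ 2, 1, fun b hb n hn => ?_⟩
  obtain ⟨m, rfl⟩ : ∃ m, n = m + 1 := ⟨n - 1, by omega⟩
  have hmod := modEq_pow_mul_of_linear_recurrence (fun k => (s k : ℤ)) α₁ α₂
    ((b : ℤ) ^ (m + 1)) hrec (m + 1)
  have hs := le_pow_of_linear_recurrence s α₁ α₂ K hrec hK.ge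
  have hx : (K : ℤ) ^ (m + 1 + 1) + K ≤ (b : ℤ) ^ (m + 1) := by
    have hb' : (2 * K ^ 2 : ℤ) ≤ b := by exact_mod_cast hb
    calc (K : ℤ) ^ (m + 1 + 1) + K
        ≤ (K : ℤ) ^ (2 * (m + 1)) + (K : ℤ) ^ (2 * (m + 1)) := by
          gcongr
          · omega
          · exact le_self_pow₀ hK1 (by omega)
      _ = 2 ^ 1 * ((K : ℤ) ^ 2) ^ (m + 1) := by rw [pow_mul]; ring
      _ ≤ 2 ^ (m + 1) * ((K : ℤ) ^ 2) ^ (m + 1) := by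
          gcongr
          · norm_num
      _ = (2 * (K : ℤ) ^ 2) ^ (m + 1) := by rw [mul_pow]
      _ ≤ (b : ℤ) ^ (m + 1) := by gcongr
  rw [sq (m + 1), pow_mul]
  generalize (b : ℤ) ^ (m + 1) = x at hmod hx ⊢
  have hc : α₁ * (s (m + 1) : ℤ) + s (m + 1 + 1) = -α₂ * s m := by
    linear_combination hrec m
  simp only [hc] at hmod
  have hsn := hs (m + 1)
  have hα : |α₂| = -α₂ := abs_of_neg hα₂
  have hα₁ := neg_abs_le α₁
  have hα₁' := abs_nonneg α₁
  have hc0 : 0 ≤ -α₂ * (s m : ℤ) := mul_nonneg (by omega) (by positivity)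
  have hcx : -α₂ * (s m : ℤ) < x := by
    have : -α₂ * (s m : ℤ) ≤ K * (K : ℤ) ^ (m + 1) :=
      mul_le_mul (by omega) (hs m) (by positivity) (by positivity)
    rw [pow_succ' (K : ℤ) (m + 1)] at hx
    omega
  have hx0 : 0 < x := by omega
  have hlt : (s (m + 1) : ℤ) * x + -α₂ * s m < x ^ 2 + α₁ * x + α₂ := by
    have h1 : (s (m + 1) + 1 + |α₁| + |α₂|) * x ≤ x * x :=
      mul_le_mul_of_nonneg_right (by omega) hx0.le
    have h2 : |α₂| ≤ |α₂| * x := le_mul_of_one_le_right (abs_nonneg _) hx0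
    have h3 : -|α₁| * x ≤ α₁ * x := mul_le_mul_of_nonneg_right hα₁ hx0.le
    linarith
  rw [hmod, Int.emod_eq_of_lt (by positivity) hlt, add_comm (_ * x),
    Int.add_mul_ediv_right _ _ hx0.ne', Int.ediv_eq_zero_of_lt hc0 hcx, zero_add]
end

section
/- Let s : ℕ → ℕ be a sequence satisfying s(n+2) + α₁·s(n+1) + α₂·s(n) = 0 for all n ≥ 0, with integer coefficients α₁, α₂ and α₂ < 0. Let B(X) = X² + α₁X + α₂ and A(X) = s(0)·X + (α₁·s(0) + s(1)). Then there exist natural numbers b₀ and n₀ such that for every b ≥ b₀ and every n ≥ n₀: |α₂|·s(n) = ((b^{n(n+1)}·A(b^n)) mod B(b^n)) mod b^n. -/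
/-- Multiplying `A(x)` by `x ^ (k + 1)` and reducing modulo `B(x)` shifts the recurrence. -/
theorem pow_mul_modEq_of_recurrence (s : ℕ → ℤ) (α₁ α₂ x : ℤ)
    (hrec : ∀ n : ℕ, s (n + 2) + α₁ * s (n + 1) + α₂ * s n = 0) (k : ℕ) :
    x ^ (k + 1) * (s 0 * x + (α₁ * s 0 + s 1)) ≡ s (k + 1) * x - α₂ * s k
      [ZMOD x ^ 2 + α₁ * x + α₂] := by
  induction k with
  | zero => exact Int.modEq_iff_dvd.2 ⟨-s 0, by ring⟩
  | succ k ih =>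
    calc x ^ (k + 1 + 1) * (s 0 * x + (α₁ * s 0 + s 1))
        = x * (x ^ (k + 1) * (s 0 * x + (α₁ * s 0 + s 1))) := by ring
      _ ≡ x * (s (k + 1) * x - α₂ * s k) [ZMOD x ^ 2 + α₁ * x + α₂] := ih.mul_left x
      _ ≡ s (k + 1 + 1) * x - α₂ * s (k + 1) [ZMOD x ^ 2 + α₁ * x + α₂] :=
        Int.modEq_iff_dvd.2 ⟨-s (k + 1), by linear_combination x * hrec k⟩

/-- A natural sequence with `s (n + 2) ≤ p * s (n + 1) + q * s n` grows at most geometrically. -/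
theorem le_mul_pow_of_recurrence_le (s : ℕ → ℕ) (p q : ℕ)
    (h : ∀ n, s (n + 2) ≤ p * s (n + 1) + q * s n) (n : ℕ) :
    s n ≤ (s 0 + s 1) * (p + q + 1) ^ n := by
  induction n using Nat.twoStepInduction with
  | zero => simp
  | one => nlinarith [Nat.zero_le (s 0 * (p + q)), Nat.zero_le (s 1 * (p + q))]
  | more n h₀ h₁ =>
    have h₂ : s n ≤ (s 0 + s 1) * (p + q + 1) ^ (n + 1) :=
      h₀.trans (by gcongr <;> omega)
    calc s (n + 2) ≤ p * s (n + 1) + q * s n := h n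
      _ ≤ p * ((s 0 + s 1) * (p + q + 1) ^ (n + 1))
          + q * ((s 0 + s 1) * (p + q + 1) ^ (n + 1)) := by gcongr
      _ ≤ (p + q + 1) * ((s 0 + s 1) * (p + q + 1) ^ (n + 1)) := by
        rw [← add_mul]; exact Nat.mul_le_mul_right _ (Nat.le_succ _)
      _ = (s 0 + s 1) * (p + q + 1) ^ (n + 2) := by ring

/-- A natural sequence with `s (n + 2) ≤ p * s (n + 1) + q * s n` is eventually dominated by
`b ^ n`, uniformly in large `b`. -/
theorem exists_forall_lt_pow_of_recurrence_le (s : ℕ → ℕ) (p q : ℕ)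
    (h : ∀ n, s (n + 2) ≤ p * s (n + 1) + q * s n) :
    ∃ b₀ : ℕ, ∀ b ≥ b₀, ∀ n ≥ 1, s (n + 1) + q * s n + p + q < b ^ n := by
  set c := p + q + 1
  set M := s 0 + s 1
  refine ⟨((2 * M + 1) * c + 1) * c, fun b hb n hn => ?_⟩
  have hs : ∀ k, s k ≤ M * c ^ k := le_mul_pow_of_recurrence_le s p q h
  have hcn : 0 < c ^ n := by positivity
  calc s (n + 1) + q * s n + p + q
      ≤ M * c ^ (n + 1) + c * (M * c ^ n) + c * c ^ n := by
        have h₁ : q * s n ≤ c * (M * c ^ n) := Nat.mul_le_mul (by omega) (hs n)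
        have h₂ : c ≤ c * c ^ n := Nat.le_mul_of_pos_right c hcn
        have h₃ := hs (n + 1)
        omega
    _ = (2 * M + 1) * c * c ^ n := by ring
    _ < ((2 * M + 1) * c + 1) * c ^ n := by gcongr; omega
    _ ≤ ((2 * M + 1) * c + 1) ^ n * c ^ n := by
        gcongr
        exact Nat.le_self_pow (by omega) _
    _ = (((2 * M + 1) * c + 1) * c) ^ n := (mul_pow _ _ _).symm
    _ ≤ b ^ n := by gcongr


/-- Degree 2, negative free coefficient, remainder-remainder representation:
if `s (n+2) + α₁ · s (n+1) + α₂ · s n = 0` with `α₂ < 0`, `B(X) = X² + α₁ X + α₂` and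
`A(X) = s 0 · X + (α₁ · s 0 + s 1)`, then there exist `b₀, n₀` such that for all
`b ≥ b₀` and `n ≥ n₀`: `|α₂| · s n = ((b^(n(n+1)) · A(b^n)) mod B(b^n)) mod b^n`. -/
theorem stmt_13 (s : ℕ → ℕ) (α₁ α₂ : ℤ) (hα₂ : α₂ < 0)
    (hrec : ∀ n : ℕ, (s (n + 2) : ℤ) + α₁ * (s (n + 1) : ℤ) + α₂ * (s n : ℤ) = 0) :
    ∃ b₀ n₀ : ℕ, ∀ b : ℕ, b₀ ≤ b → ∀ n : ℕ, n₀ ≤ n →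
      |α₂| * (s n : ℤ) =
        ((b : ℤ) ^ (n * (n + 1)) * ((s 0 : ℤ) * (b : ℤ) ^ n + (α₁ * (s 0 : ℤ) + (s 1 : ℤ))))
          % (((b : ℤ) ^ n) ^ 2 + α₁ * (b : ℤ) ^ n + α₂) % (b : ℤ) ^ n := by
  obtain ⟨b₀, hb₀⟩ := exists_forall_lt_pow_of_recurrence_le s α₁.natAbs α₂.natAbs fun n => by
    zify
    nlinarith [hrec n, neg_abs_le α₁, neg_abs_le α₂, Int.natCast_nonneg (s n),
      Int.natCast_nonneg (s (n + 1))]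
  refine ⟨b₀, 1, fun b hb n hn => ?_⟩
  have hlt := hb₀ b hb n hn
  zify at hlt
  rw [pow_mul (b : ℤ) n (n + 1)]
  set x : ℤ := (b : ℤ) ^ n
  have hmod := pow_mul_modEq_of_recurrence (fun k => (s k : ℤ)) α₁ α₂ x hrec n
  have hα₁ := neg_abs_le α₁
  rw [abs_of_neg hα₂] at hlt ⊢
  have hs₀ : (0 : ℤ) ≤ s n := Int.natCast_nonneg _
  have hs₁ : (0 : ℤ) ≤ s (n + 1) := Int.natCast_nonneg _
  have hp : 0 ≤ -α₂ * s n := mul_nonneg (by omega) hs₀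
  have hx : 1 ≤ x := by linarith [abs_nonneg α₁]
  have hr : 0 ≤ (s (n + 1) : ℤ) * x - α₂ * s n := by
    linarith [mul_nonneg hs₁ (zero_le_one.trans hx)]
  have hB : (s (n + 1) : ℤ) * x - α₂ * s n < x ^ 2 + α₁ * x + α₂ := by
    have hgap : -α₂ * s n - α₂ + 1 ≤ x - s (n + 1) + α₁ := by linarith
    nlinarith [mul_le_mul hgap hx zero_le_one (by linarith)]
  rw [hmod.eq, Int.emod_eq_of_lt hr hB]
  have hcomm : (s (n + 1) : ℤ) * x - α₂ * s n = -α₂ * s n + x * s (n + 1) := by ring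
  rw [hcomm, Int.add_mul_emod_self_left, Int.emod_eq_of_lt hp]
  linarith [abs_nonneg α₁]
end

section
/- Let s : ℕ → ℕ be a sequence satisfying s(n+3) + α₁·s(n+2) + α₂·s(n+1) + α₃·s(n) = 0 for all n ≥ 0, with integer coefficients α₁, α₂, α₃ such that α₂ ≤ 0 and α₃ < 0. Let B(X) = X³ + α₁X² + α₂X + α₃ and A(X) = s(0)·X² + (α₁·s(0) + s(1))·X + (α₂·s(0) + α₁·s(1) + s(2)). Then there exist natural numbers b₀ and n₀ such that for every b ≥ b₀ and every n ≥ n₀: s(n) = ⌊((b^{n²}·A(b^n)) mod B(b^n)) / b^{2n}⌋. -/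
/-- The numerator `A(X)` times `X ^ n` is congruent modulo `B(X)` to the numerator of the generating
function of the sequence shifted by `n`. -/
theorem exists_pow_mul_numerator_eq (s : ℕ → ℤ) (a b c x : ℤ)
    (hrec : ∀ n, s (n + 3) + a * s (n + 2) + b * s (n + 1) + c * s n = 0) (n : ℕ) :
    ∃ q, x ^ n * (s 0 * x ^ 2 + (a * s 0 + s 1) * x + (b * s 0 + a * s 1 + s 2)) =
      (s n * x ^ 2 + (a * s n + s (n + 1)) * x + (b * s n + a * s (n + 1) + s (n + 2))) +
        (x ^ 3 + a * x ^ 2 + b * x + c) * q := by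
  induction n with
  | zero => exact ⟨0, by ring⟩
  | succ n ih =>
    obtain ⟨q, hq⟩ := ih
    refine ⟨x * q + s n, ?_⟩
    rw [pow_succ, mul_right_comm, hq]
    linear_combination -hrec n

/-- A third-order linear recurrent sequence grows at most geometrically. -/
theorem abs_le_mul_pow_of_recurrence_s14 (s : ℕ → ℤ) (a b c S M : ℤ)
    (hrec : ∀ n, s (n + 3) + a * s (n + 2) + b * s (n + 1) + c * s n = 0)
    (hM : 1 + |a| + |b| + |c| ≤ M) (h0 : |s 0| ≤ S) (h1 : |s 1| ≤ S) (h2 : |s 2| ≤ S) (n : ℕ) :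
    |s n| ≤ S * M ^ n := by
  have hS : 0 ≤ S := (abs_nonneg _).trans h0
  have ha := abs_nonneg a
  have hb := abs_nonneg b
  have hc := abs_nonneg c
  have hM1 : 1 ≤ M := by linarith
  suffices h : ∀ n, |s n| ≤ S * M ^ n ∧ |s (n + 1)| ≤ S * M ^ (n + 1) ∧
      |s (n + 2)| ≤ S * M ^ (n + 2) from (h n).1
  intro n
  induction n with
  | zero =>
    exact ⟨by simpa using h0, h1.trans (le_mul_of_one_le_right hS (one_le_pow₀ hM1)),
      h2.trans (le_mul_of_one_le_right hS (one_le_pow₀ hM1))⟩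
  | succ n ih =>
    obtain ⟨i0, i1, i2⟩ := ih
    refine ⟨i1, i2, ?_⟩
    have e : s (n + 1 + 2) = -(a * s (n + 2) + b * s (n + 1) + c * s n) := by
      linear_combination hrec n
    have p1 : S * M ^ (n + 1) ≤ S * M ^ (n + 2) := by gcongr; omega
    have p0 : S * M ^ n ≤ S * M ^ (n + 2) := by gcongr; omega
    have hP : 0 ≤ S * M ^ (n + 2) := by positivity
    calc |s (n + 1 + 2)| ≤ |a * s (n + 2)| + |b * s (n + 1)| + |c * s n| := by
          rw [e, abs_neg]; exact abs_add_three _ _ _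
      _ = |a| * |s (n + 2)| + |b| * |s (n + 1)| + |c| * |s n| := by simp only [abs_mul]
      _ ≤ |a| * (S * M ^ (n + 2)) + |b| * (S * M ^ (n + 2)) + |c| * (S * M ^ (n + 2)) := by
          gcongr
          exacts [i1.trans p1, i0.trans p0]
      _ ≤ M * (S * M ^ (n + 2)) := by nlinarith
      _ = S * M ^ (n + 1 + 2) := by ring

/-- If `u x² + v x + w` has small nonnegative coefficients, it is its own remainder modulo the monic
cubic, and its leading coefficient is the quotient by `x²`. -/
theorem emod_cubic_ediv_sq {a b c u v w x T q : ℤ} (hu : 0 ≤ u) (hv : 0 ≤ v) (hw : 0 ≤ w)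
    (hT : 0 < T) (hv' : 3 * v ≤ T) (hw' : 3 * w ≤ T) (hu' : u + 1 + |a| + |b| + |c| ≤ T)
    (hx : T ≤ x) :
    u = ((u * x ^ 2 + v * x + w) + (x ^ 3 + a * x ^ 2 + b * x + c) * q) %
      (x ^ 3 + a * x ^ 2 + b * x + c) / x ^ 2 := by
  have hx1 : 1 ≤ x := by linarith
  have hxx : x ≤ x ^ 2 := by nlinarith
  have hlow : v * x + w < x ^ 2 := by nlinarith
  have hB : (u + 1) * x ^ 2 ≤ x ^ 3 + a * x ^ 2 + b * x + c := by
    have h1 : (u + 1 + |a| + |b| + |c|) * x ^ 2 ≤ x * x ^ 2 := by gcongr; linarith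
    have ha : -|a| * x ^ 2 ≤ a * x ^ 2 := by gcongr; exact neg_abs_le a
    have hb : -|b| * x ≤ b * x := by gcongr; exact neg_abs_le b
    have hb' : |b| * x ≤ |b| * x ^ 2 := by gcongr
    have hc' : |c| * 1 ≤ |c| * x ^ 2 := by gcongr; linarith
    nlinarith [neg_abs_le c]
  have hvx : 0 ≤ v * x := by positivity
  rw [Int.add_mul_emod_self_left, Int.emod_eq_of_lt (by positivity) (by linarith)]
  symm
  rw [Int.ediv_eq_iff_of_pos (by positivity)]
  constructor <;> nlinarith


/-- Degree 3, nonpositive coefficients case, remainder-quotient representation: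
if `s (n+3) + α₁ · s (n+2) + α₂ · s (n+1) + α₃ · s n = 0` with `α₂ ≤ 0` and `α₃ < 0`,
`B(X) = X³ + α₁ X² + α₂ X + α₃` and
`A(X) = s 0 · X² + (α₁ · s 0 + s 1) · X + (α₂ · s 0 + α₁ · s 1 + s 2)`, then there exist
`b₀, n₀` such that for all `b ≥ b₀` and `n ≥ n₀`:
`s n = ⌊((b^(n²) · A(b^n)) mod B(b^n)) / b^(2n)⌋`. -/
theorem stmt_14 (s : ℕ → ℕ) (α₁ α₂ α₃ : ℤ) (hα₂ : α₂ ≤ 0) (hα₃ : α₃ < 0)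
    (hrec : ∀ n : ℕ, (s (n + 3) : ℤ) + α₁ * (s (n + 2) : ℤ) + α₂ * (s (n + 1) : ℤ)
      + α₃ * (s n : ℤ) = 0) :
    ∃ b₀ n₀ : ℕ, ∀ b : ℕ, b₀ ≤ b → ∀ n : ℕ, n₀ ≤ n →
      (s n : ℤ) =
        ((b : ℤ) ^ (n ^ 2) *
            ((s 0 : ℤ) * ((b : ℤ) ^ n) ^ 2 + (α₁ * (s 0 : ℤ) + (s 1 : ℤ)) * (b : ℤ) ^ n
              + (α₂ * (s 0 : ℤ) + α₁ * (s 1 : ℤ) + (s 2 : ℤ))))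
          % (((b : ℤ) ^ n) ^ 3 + α₁ * ((b : ℤ) ^ n) ^ 2 + α₂ * (b : ℤ) ^ n + α₃)
          / (b : ℤ) ^ (2 * n) := by
  set M : ℤ := 1 + |α₁| + |α₂| + |α₃| with hM
  set S : ℤ := (s 0 : ℤ) + s 1 + s 2 + 1 with hS
  have hM1 : 1 ≤ M := by linarith [abs_nonneg α₁, abs_nonneg α₂, abs_nonneg α₃]
  have hS1 : 1 ≤ S := by omega
  have hbound (n : ℕ) : (s n : ℤ) ≤ S * M ^ n :=
    (le_abs_self _).trans <| abs_le_mul_pow_of_recurrence_s14 (fun k => (s k : ℤ)) α₁ α₂ α₃ S M hrec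
      le_rfl (by simp; omega) (by simp; omega) (by simp; omega) n
  refine ⟨(3 * S * M * M).toNat, 2, fun b hb n hn => ?_⟩
  have hb : 3 * S * M * M ≤ (b : ℤ) := Int.toNat_le.mp hb
  obtain ⟨q, hq⟩ := exists_pow_mul_numerator_eq (fun k => (s k : ℤ)) α₁ α₂ α₃ ((b : ℤ) ^ n) hrec n
  rw [sq n, pow_mul, mul_comm 2 n, pow_mul, hq]
  have hSM : 1 ≤ 3 * S * M := by nlinarith
  have hX : 3 * S * M * M ^ n ≤ (b : ℤ) ^ n := by
    calc 3 * S * M * M ^ n ≤ (3 * S * M) ^ n * M ^ n := by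
          gcongr; exact le_self_pow₀ hSM (by omega)
      _ = (3 * S * M * M) ^ n := (mul_pow _ _ _).symm
      _ ≤ (b : ℤ) ^ n := by gcongr
  obtain ⟨m, rfl⟩ := Nat.exists_eq_add_of_le' hn
  have r0 := hrec m
  have r1 := hrec (m + 1)
  have hP : 1 ≤ M ^ (m + 2) := one_le_pow₀ hM1
  have hSP : 1 ≤ S * M ^ (m + 2) := by nlinarith
  have p1 : (s (m + 1) : ℤ) ≤ S * M ^ (m + 2) :=
    (hbound _).trans (by gcongr; omega)
  have p0 : (s m : ℤ) ≤ S * M ^ (m + 2) :=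
    (hbound _).trans (by gcongr; omega)
  have hv : α₁ * (s (m + 2) : ℤ) + s (m + 2 + 1) = -α₂ * s (m + 1) + -α₃ * s m := by
    linear_combination r0
  have hw : α₂ * (s (m + 2) : ℤ) + α₁ * s (m + 2 + 1) + s (m + 2 + 2) = -α₃ * s (m + 1) := by
    linear_combination r1
  have hα₂' : 0 ≤ -α₂ := by linarith
  have hα₃' : 0 ≤ -α₃ := by linarith
  have hαM : -α₂ + -α₃ ≤ M := by linarith [neg_le_abs α₂, neg_le_abs α₃, abs_nonneg α₁]
  have hMP : (-α₂ + -α₃) * (S * M ^ (m + 2)) ≤ M * (S * M ^ (m + 2)) := by gcongr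
  have q1 : -α₂ * (s (m + 1) : ℤ) ≤ -α₂ * (S * M ^ (m + 2)) := by gcongr
  have q2 : -α₃ * (s m : ℤ) ≤ -α₃ * (S * M ^ (m + 2)) := by gcongr
  have q3 : -α₃ * (s (m + 1) : ℤ) ≤ -α₃ * (S * M ^ (m + 2)) := by gcongr
  have q4 : 0 ≤ -α₂ * (S * M ^ (m + 2)) := by positivity
  have hT : 3 * S * M * M ^ (m + 2) = 3 * (M * (S * M ^ (m + 2))) := by ring
  have t1 : M ≤ M * (S * M ^ (m + 2)) := le_mul_of_one_le_right (by linarith) hSP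
  have t2 : S * M ^ (m + 2) ≤ M * (S * M ^ (m + 2)) := le_mul_of_one_le_left (by linarith) hM1
  refine emod_cubic_ediv_sq (T := 3 * S * M * M ^ (m + 2)) (by positivity) ?_ ?_ (by positivity)
    ?_ ?_ ?_ hX
  · rw [hv]; positivity
  · rw [hw]; positivity
  · rw [hv, hT]; linarith
  · rw [hw, hT]; linarith
  · rw [hT]; linarith [hbound (m + 2)]
end

section
/- Let F : ℕ → ℕ be the Fibonacci sequence, defined by F(0) = 0, F(1) = 1 and F(n+2) = F(n+1) + F(n). Then for every integer n ≥ 1: F(n) = ⌊(3^{n²} mod (3^{2n} − 3^n − 1)) / 3^n⌋ and F(n) = (3^{n²+n} mod (3^{2n} − 3^n − 1)) mod 3^n. -/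
/-- Powers of `X` modulo `X² - X - 1` have Fibonacci coefficients. -/
theorem pow_succ_modEq_fib (F : ℕ → ℕ) (h0 : F 0 = 0) (h1 : F 1 = 1)
    (hrec : ∀ n : ℕ, F (n + 2) = F (n + 1) + F n) (X : ℤ) (k : ℕ) :
    X ^ (k + 1) ≡ F (k + 1) * X + F k [ZMOD X ^ 2 - X - 1] := by
  induction k with
  | zero => simp [h0, h1, Int.ModEq.refl]
  | succ k ih =>
    rw [pow_succ X (k + 1)]
    refine (ih.mul_right X).trans ?_
    rw [Int.modEq_iff_dvd]
    refine ⟨-F (k + 1), ?_⟩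
    rw [hrec]
    push_cast
    ring

theorem fib_add_two_le_three_pow (F : ℕ → ℕ) (h0 : F 0 = 0) (h1 : F 1 = 1)
    (hrec : ∀ n : ℕ, F (n + 2) = F (n + 1) + F n) (m : ℕ) :
    F m + 2 ≤ 3 ^ (m + 1) ∧ F (m + 1) + 2 ≤ 3 ^ (m + 1) ∧ F (m + 2) + 2 ≤ 3 ^ (m + 1) := by
  induction m with
  | zero => simp [hrec, h0, h1]
  | succ m ih =>
    have := hrec (m + 1)
    rw [pow_succ 3 (m + 1)]
    refine ⟨?_, ?_, ?_⟩ <;> grind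

/-- A two-digit number in base `X` with digits at most `X - 2` is reduced modulo `X² - X - 1`. -/
theorem emod_eq_of_modEq_of_digits {X a b y : ℤ} (ha : 0 ≤ a) (hb : 0 ≤ b)
    (haX : a + 2 ≤ X) (hbX : b + 2 ≤ X) (h : y ≡ a * X + b [ZMOD X ^ 2 - X - 1]) :
    y % (X ^ 2 - X - 1) = a * X + b := by
  rw [h.eq]
  exact Int.emod_eq_of_lt (by nlinarith) (by nlinarith)


/-- Fibonacci representations: for `n ≥ 1`,
`F n = ⌊(3^(n²) mod (3^(2n) - 3^n - 1)) / 3^n⌋` and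
`F n = (3^(n²+n) mod (3^(2n) - 3^n - 1)) mod 3^n`. -/
theorem stmt_15 (F : ℕ → ℕ) (h0 : F 0 = 0) (h1 : F 1 = 1)
    (hrec : ∀ n : ℕ, F (n + 2) = F (n + 1) + F n) :
    ∀ n : ℕ, 1 ≤ n →
      (F n : ℤ) = (3 : ℤ) ^ (n ^ 2) % ((3 : ℤ) ^ (2 * n) - 3 ^ n - 1) / 3 ^ n ∧
      (F n : ℤ) = (3 : ℤ) ^ (n ^ 2 + n) % ((3 : ℤ) ^ (2 * n) - 3 ^ n - 1) % 3 ^ n := by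
  intro n hn
  obtain ⟨m, rfl⟩ := Nat.exists_eq_add_of_le' hn
  obtain ⟨hb0, hb1, hb2⟩ := fib_add_two_le_three_pow F h0 h1 hrec m
  have e1 : (3 : ℤ) ^ ((m + 1) ^ 2) = (3 ^ (m + 1)) ^ (m + 1) := by rw [← pow_mul, sq]
  have e2 : (3 : ℤ) ^ ((m + 1) ^ 2 + (m + 1)) = (3 ^ (m + 1)) ^ (m + 1 + 1) := by
    rw [← pow_mul]; ring
  have e3 : (3 : ℤ) ^ (2 * (m + 1)) = (3 ^ (m + 1)) ^ 2 := by rw [← pow_mul, mul_comm]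
  rw [e1, e2, e3]
  zify at hb0 hb1 hb2
  generalize (3 : ℤ) ^ (m + 1) = X at *
  rw [emod_eq_of_modEq_of_digits (by positivity) (by positivity) hb1 hb0
      (pow_succ_modEq_fib F h0 h1 hrec X m),
    emod_eq_of_modEq_of_digits (by positivity) (by positivity) hb2 hb1
      (pow_succ_modEq_fib F h0 h1 hrec X (m + 1))]
  constructor
  · rw [add_comm (_ * X), Int.add_mul_ediv_right _ _ (by omega),
      Int.ediv_eq_zero_of_lt (by positivity) (by omega), zero_add]
  · rw [add_comm (_ * X), Int.add_mul_emod_self_right,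
      Int.emod_eq_of_lt (by positivity) (by omega)]
end

section
/- Let L : ℕ → ℕ be the Lucas sequence, defined by L(0) = 2, L(1) = 1 and L(n+2) = L(n+1) + L(n). Then for every integer n ≥ 1: L(n) = ⌊((2·4^{n²+n} − 4^{n²}) mod (4^{2n} − 4^n − 1)) / 4^n⌋ and L(n) = ((2·5^{n²+2n} − 5^{n²+n}) mod (5^{2n} − 5^n − 1)) mod 5^n. -/
theorem lucas_dvd (L : ℕ → ℕ) (h0 : L 0 = 2) (h1 : L 1 = 1)
    (hrec : ∀ n : ℕ, L (n + 2) = L (n + 1) + L n) (x : ℤ) (k : ℕ) :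
    x ^ 2 - x - 1 ∣ 2 * x ^ (k + 2) - x ^ (k + 1) - (L (k + 1) * x + L k) := by
  induction k with
  | zero => exact ⟨2, by simp [h0, h1]; ring⟩
  | succ k ih =>
    obtain ⟨c, hc⟩ := ih
    refine ⟨c * x + L (k + 1), ?_⟩
    rw [hrec k]
    push_cast
    linear_combination x * hc

theorem lucas_emod (L : ℕ → ℕ) (h0 : L 0 = 2) (h1 : L 1 = 1)
    (hrec : ∀ n : ℕ, L (n + 2) = L (n + 1) + L n) (x : ℤ) (k : ℕ)
    (hk : (L k : ℤ) + 2 ≤ x) (hk' : (L (k + 1) : ℤ) + 2 ≤ x) :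
    (2 * x ^ (k + 2) - x ^ (k + 1)) % (x ^ 2 - x - 1) = L (k + 1) * x + L k := by
  rw [Int.emod_eq_emod_iff_emod_sub_eq_zero.mpr
    (Int.emod_eq_zero_of_dvd (lucas_dvd L h0 h1 hrec x k))]
  apply Int.emod_eq_of_lt
  · have : 0 ≤ x := by omega
    positivity
  · nlinarith

theorem lucas_add_two_le_four_pow (L : ℕ → ℕ) (h0 : L 0 = 2) (h1 : L 1 = 1)
    (hrec : ∀ n : ℕ, L (n + 2) = L (n + 1) + L n) (k : ℕ) :
    L k + 2 ≤ 4 ^ (k + 1) ∧ L (k + 1) + 2 ≤ 4 ^ (k + 1) := by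
  induction k with
  | zero => simp [h0, h1]
  | succ k ih =>
    have : L (k + 1 + 1) = _ := hrec k
    have h4 := pow_succ 4 (k + 1)
    omega

theorem lucas_add_two_le_five_pow (L : ℕ → ℕ) (h0 : L 0 = 2) (h1 : L 1 = 1)
    (hrec : ∀ n : ℕ, L (n + 2) = L (n + 1) + L n) (k : ℕ) :
    L (k + 1) + 2 ≤ 5 ^ (k + 1) ∧ L (k + 2) + 2 ≤ 5 ^ (k + 1) := by
  induction k with
  | zero => simp [h0, h1, hrec 0]
  | succ k ih =>
    have h := hrec (k + 1)
    have e : L (k + 1 + 1) = L (k + 2) := rfl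
    have h5 := pow_succ 5 (k + 1)
    omega

/-- Lucas number representations: for `n ≥ 1`,
`L n = ⌊((2·4^(n²+n) - 4^(n²)) mod (4^(2n) - 4^n - 1)) / 4^n⌋` and
`L n = ((2·5^(n²+2n) - 5^(n²+n)) mod (5^(2n) - 5^n - 1)) mod 5^n`. -/
theorem stmt_16 (L : ℕ → ℕ) (h0 : L 0 = 2) (h1 : L 1 = 1)
    (hrec : ∀ n : ℕ, L (n + 2) = L (n + 1) + L n) :
    ∀ n : ℕ, 1 ≤ n →
      (L n : ℤ) = (2 * (4 : ℤ) ^ (n ^ 2 + n) - 4 ^ (n ^ 2))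
          % ((4 : ℤ) ^ (2 * n) - 4 ^ n - 1) / 4 ^ n ∧
      (L n : ℤ) = (2 * (5 : ℤ) ^ (n ^ 2 + 2 * n) - 5 ^ (n ^ 2 + n))
          % ((5 : ℤ) ^ (2 * n) - 5 ^ n - 1) % 5 ^ n := by
  intro n hn
  obtain ⟨k, rfl⟩ : ∃ k, n = k + 1 := ⟨n - 1, by omega⟩
  constructor
  · obtain ⟨ha, hb⟩ := lucas_add_two_le_four_pow L h0 h1 hrec k
    have hx := lucas_emod L h0 h1 hrec (4 ^ (k + 1)) k (by exact_mod_cast ha) (by exact_mod_cast hb)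
    have e1 : (4 : ℤ) ^ ((k + 1) ^ 2 + (k + 1)) = (4 ^ (k + 1)) ^ (k + 2) := by
      rw [← pow_mul]; congr 1; ring
    have e2 : (4 : ℤ) ^ ((k + 1) ^ 2) = (4 ^ (k + 1)) ^ (k + 1) := by
      rw [← pow_mul]; congr 1; ring
    have e3 : (4 : ℤ) ^ (2 * (k + 1)) = (4 ^ (k + 1)) ^ 2 := by
      rw [← pow_mul]; congr 1; ring
    have hlt : (L k : ℤ) < 4 ^ (k + 1) := by
      have : L k < 4 ^ (k + 1) := by omega
      exact_mod_cast this
    rw [e1, e2, e3, hx, add_comm (_ * _), Int.add_mul_ediv_right _ _ (by positivity),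
      Int.ediv_eq_zero_of_lt (by positivity) hlt, zero_add]
  · obtain ⟨ha, hb⟩ := lucas_add_two_le_five_pow L h0 h1 hrec k
    have hx := lucas_emod L h0 h1 hrec (5 ^ (k + 1)) (k + 1)
      (by exact_mod_cast ha) (by exact_mod_cast hb)
    have e1 : (5 : ℤ) ^ ((k + 1) ^ 2 + 2 * (k + 1)) = (5 ^ (k + 1)) ^ (k + 1 + 2) := by
      rw [← pow_mul]; congr 1; ring
    have e2 : (5 : ℤ) ^ ((k + 1) ^ 2 + (k + 1)) = (5 ^ (k + 1)) ^ (k + 1 + 1) := by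
      rw [← pow_mul]; congr 1; ring
    have e3 : (5 : ℤ) ^ (2 * (k + 1)) = (5 ^ (k + 1)) ^ 2 := by
      rw [← pow_mul]; congr 1; ring
    have hlt : (L (k + 1) : ℤ) < 5 ^ (k + 1) := by
      have : L (k + 1) < 5 ^ (k + 1) := by omega
      exact_mod_cast this
    rw [e1, e2, e3, hx, add_comm (_ * _), Int.add_mul_emod_self_right,
      Int.emod_eq_of_lt (by positivity) hlt]
end

section
/- Let P : ℕ → ℕ be the Pell sequence, defined by P(0) = 0, P(1) = 1 and P(n+2) = 2·P(n+1) + P(n). Then for every integer n ≥ 1: P(n) = ⌊(4^{n²} mod (4^{2n} − 2·4^n − 1)) / 4^n⌋ and P(n) = (3^{n²+n} mod (3^{2n} − 2·3^n − 1)) mod 3^n. -/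
/-- Powers of `x` modulo its characteristic polynomial `x² - 2x - 1` have Pell coefficients. -/
theorem pell_pow_modEq (P : ℕ → ℕ) (h0 : P 0 = 0) (h1 : P 1 = 1)
    (hrec : ∀ n : ℕ, P (n + 2) = 2 * P (n + 1) + P n) (x : ℤ) (n : ℕ) :
    x ^ (n + 1) ≡ P (n + 1) * x + P n [ZMOD x ^ 2 - 2 * x - 1] := by
  induction n with
  | zero => simp [h0, h1]
  | succ n ih =>
    rw [pow_succ x (n + 1)]
    refine (ih.mul_right x).trans (Int.modEq_iff_dvd.mpr ⟨-P (n + 1), ?_⟩)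
    rw [hrec]
    push_cast
    ring

theorem pell_remainder_emod {a b x : ℤ} (ha : 0 ≤ a) (hb : 0 ≤ b) (hax : a + 3 ≤ x)
    (hbx : b + 3 ≤ x) : (a * x + b) % (x ^ 2 - 2 * x - 1) = a * x + b := by
  have hx : 0 ≤ x := by linarith
  exact Int.emod_eq_of_lt (by positivity) (by nlinarith)

theorem pell_add_three_le_four_pow (P : ℕ → ℕ) (h0 : P 0 = 0) (h1 : P 1 = 1)
    (hrec : ∀ n : ℕ, P (n + 2) = 2 * P (n + 1) + P n) (n : ℕ) :
    P (n + 1) + 3 ≤ 4 ^ (n + 1) ∧ P n + 3 ≤ 4 ^ (n + 1) := by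
  induction n with
  | zero => simp [h0, h1]
  | succ n ih =>
    rw [hrec, pow_succ 4 (n + 1)]
    omega

theorem pell_add_three_le_three_pow (P : ℕ → ℕ) (h0 : P 0 = 0) (h1 : P 1 = 1)
    (hrec : ∀ n : ℕ, P (n + 2) = 2 * P (n + 1) + P n) (n : ℕ) :
    P (n + 3) + 3 ≤ 3 ^ (n + 2) ∧ P (n + 2) + 3 ≤ 3 ^ (n + 2) := by
  induction n with
  | zero => simp [hrec, h0, h1]
  | succ n ih =>
    have h : P (n + 1 + 3) = 2 * P (n + 3) + P (n + 2) := hrec (n + 2)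
    rw [h, show n + 1 + 2 = n + 3 from rfl, pow_succ 3 (n + 2)]
    omega

/-- Pell number representations: for `n ≥ 1`,
`P n = ⌊(4^(n²) mod (4^(2n) - 2·4^n - 1)) / 4^n⌋` and
`P n = (3^(n²+n) mod (3^(2n) - 2·3^n - 1)) mod 3^n`. -/
theorem stmt_17 (P : ℕ → ℕ) (h0 : P 0 = 0) (h1 : P 1 = 1)
    (hrec : ∀ n : ℕ, P (n + 2) = 2 * P (n + 1) + P n) :
    ∀ n : ℕ, 1 ≤ n →
      (P n : ℤ) = (4 : ℤ) ^ (n ^ 2) % ((4 : ℤ) ^ (2 * n) - 2 * 4 ^ n - 1) / 4 ^ n ∧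
      (P n : ℤ) = (3 : ℤ) ^ (n ^ 2 + n) % ((3 : ℤ) ^ (2 * n) - 2 * 3 ^ n - 1) % 3 ^ n := by
  intro n hn
  obtain ⟨m, rfl⟩ := Nat.exists_eq_add_of_le' hn
  constructor
  · obtain ⟨ha, hb⟩ := pell_add_three_le_four_pow P h0 h1 hrec m
    zify at ha hb
    have key := pell_pow_modEq P h0 h1 hrec (4 ^ (m + 1)) m
    rw [sq (m + 1), pow_mul, mul_comm 2, pow_mul, key,
      pell_remainder_emod (by positivity) (by positivity) ha hb,
      add_comm (_ * _), Int.add_mul_ediv_right _ _ (by positivity),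
      Int.ediv_eq_zero_of_lt (by positivity) (by linarith), zero_add]
  · rcases m with _ | m
    · norm_num [h1]
    · obtain ⟨ha, hb⟩ := pell_add_three_le_three_pow P h0 h1 hrec m
      zify at ha hb
      have key := pell_pow_modEq P h0 h1 hrec (3 ^ (m + 2)) (m + 2)
      rw [show (m + 1 + 1) ^ 2 + (m + 1 + 1) = (m + 2) * (m + 2 + 1) by ring, pow_mul,
        mul_comm 2, pow_mul, key, pell_remainder_emod (by positivity) (by positivity) ha hb,
        add_comm (_ * _), Int.add_mul_emod_self_right, Int.emod_eq_of_lt (by positivity) (by linarith)]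
end

section
/- Let T : ℕ → ℕ be the Tribonacci sequence, defined by T(0) = T(1) = 0, T(2) = 1 and T(n+3) = T(n+2) + T(n+1) + T(n). Then for every integer n ≥ 1: T(n) = ⌊(2^{n²} mod (2^{3n} − 2^{2n} − 2^n − 1)) / 2^{2n}⌋ and T(n) = (2^{n²+n} mod (2^{3n} − 2^{2n} − 2^n − 1)) mod 2^n. -/
/-- Powers of `x` reduced modulo the characteristic polynomial of the Tribonacci recurrence. -/
theorem tribonacci_pow_modEq (T : ℕ → ℕ) (h0 : T 0 = 0) (h1 : T 1 = 0) (h2 : T 2 = 1)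
    (hrec : ∀ n : ℕ, T (n + 3) = T (n + 2) + T (n + 1) + T n) (x : ℤ) (m : ℕ) :
    x ^ (m + 2) ≡ T (m + 2) * x ^ 2 + (T (m + 1) + T m) * x + T (m + 1)
      [ZMOD x ^ 3 - x ^ 2 - x - 1] := by
  induction m with
  | zero => simp [h0, h1, h2, Int.ModEq.refl]
  | succ m ih =>
    rw [show m + 1 + 2 = m + 3 by ring, show m + 1 + 1 = m + 2 by ring]
    calc x ^ (m + 3) = x ^ (m + 2) * x := by ring
      _ ≡ (T (m + 2) * x ^ 2 + (T (m + 1) + T m) * x + T (m + 1)) * x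
          [ZMOD x ^ 3 - x ^ 2 - x - 1] := ih.mul_right x
      _ ≡ _ [ZMOD x ^ 3 - x ^ 2 - x - 1] := by
        apply Int.ModEq.symm
        rw [Int.modEq_iff_dvd]
        refine ⟨T (m + 2), ?_⟩
        rw [hrec]
        push_cast
        ring

theorem tribonacci_add_le (T : ℕ → ℕ) (h0 : T 0 = 0) (h1 : T 1 = 0)
    (hrec : ∀ n : ℕ, T (n + 3) = T (n + 2) + T (n + 1) + T n) (k : ℕ) :
    T (k + 1) + T k ≤ T (k + 2) := by
  cases k with
  | zero => simp [h0, h1]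
  | succ j => exact hrec j ▸ Nat.le_add_right _ _

theorem tribonacci_le_two_pow (T : ℕ → ℕ) (h0 : T 0 = 0) (h1 : T 1 = 0) (h2 : T 2 = 1)
    (hrec : ∀ n : ℕ, T (n + 3) = T (n + 2) + T (n + 1) + T n) (k : ℕ) :
    T (k + 2) ≤ 2 ^ k := by
  induction k with
  | zero => simp [h2]
  | succ k ih =>
    have h := tribonacci_add_le T h0 h1 hrec k
    rw [show k + 1 + 2 = k + 3 by ring, hrec, pow_succ]
    omega

/-- Tribonacci representations: for `n ≥ 1`,
`T n = ⌊(2^(n²) mod (2^(3n) - 2^(2n) - 2^n - 1)) / 2^(2n)⌋` and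
`T n = (2^(n²+n) mod (2^(3n) - 2^(2n) - 2^n - 1)) mod 2^n`. -/
theorem stmt_19 (T : ℕ → ℕ) (h0 : T 0 = 0) (h1 : T 1 = 0) (h2 : T 2 = 1)
    (hrec : ∀ n : ℕ, T (n + 3) = T (n + 2) + T (n + 1) + T n) :
    ∀ n : ℕ, 1 ≤ n →
      (T n : ℤ) = (2 : ℤ) ^ (n ^ 2) % ((2 : ℤ) ^ (3 * n) - 2 ^ (2 * n) - 2 ^ n - 1)
          / 2 ^ (2 * n) ∧
      (T n : ℤ) = (2 : ℤ) ^ (n ^ 2 + n) % ((2 : ℤ) ^ (3 * n) - 2 ^ (2 * n) - 2 ^ n - 1)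
          % 2 ^ n := by
  intro n hn
  obtain rfl | ⟨k, rfl⟩ : n = 1 ∨ ∃ k, n = k + 2 := by
    rcases n with _ | _ | k
    · omega
    · simp
    · exact Or.inr ⟨k, rfl⟩
  · simp [h1]
  have e1 : (2 : ℤ) ^ ((k + 2) ^ 2) = (2 ^ (k + 2)) ^ (k + 2) := by rw [← pow_mul, sq]
  have e2 : (2 : ℤ) ^ ((k + 2) ^ 2 + (k + 2)) = (2 ^ (k + 2)) ^ (k + 1 + 2) := by
    rw [← pow_mul]; ring_nf
  have e3 : (2 : ℤ) ^ (3 * (k + 2)) = (2 ^ (k + 2)) ^ 3 := by rw [← pow_mul, mul_comm]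
  have e4 : (2 : ℤ) ^ (2 * (k + 2)) = (2 ^ (k + 2)) ^ 2 := by rw [← pow_mul, mul_comm]
  rw [e1, e2, e3, e4]
  have hx : (2 : ℤ) ^ (k + 2) = 4 * 2 ^ k := by ring
  have hy : (1 : ℤ) ≤ 2 ^ k := one_le_pow₀ (by norm_num)
  have m1 := tribonacci_pow_modEq T h0 h1 h2 hrec (2 ^ (k + 2)) k
  have m2 := tribonacci_pow_modEq T h0 h1 h2 hrec (2 ^ (k + 2)) (k + 1)
  rw [show k + 1 + 2 = k + 3 by ring, show k + 1 + 1 = k + 2 by ring] at m2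
  have b1 : (T (k + 2) : ℤ) ≤ 2 ^ k := by
    exact_mod_cast tribonacci_le_two_pow T h0 h1 h2 hrec k
  have b2 : (T (k + 1) + T k : ℤ) ≤ T (k + 2) := by
    exact_mod_cast tribonacci_add_le T h0 h1 hrec k
  have r : (T (k + 3) : ℤ) = T (k + 2) + T (k + 1) + T k := by exact_mod_cast hrec k
  have p0 : (0 : ℤ) ≤ T k := by positivity
  have p1 : (0 : ℤ) ≤ T (k + 1) := by positivity
  have p2 : (0 : ℤ) ≤ T (k + 2) := by positivity
  rw [show k + 1 + 2 = k + 3 by ring, m1, m2, r, hx]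
  generalize (2 : ℤ) ^ k = y at *
  generalize (T k : ℤ) = c at *
  generalize (T (k + 1) : ℤ) = b at *
  generalize (T (k + 2) : ℤ) = a at *
  have hlt : ∀ u v w : ℤ, u ≤ 2 * y → v ≤ 2 * y → w ≤ y →
      u * (4 * y) ^ 2 + v * (4 * y) + w < (4 * y) ^ 3 - (4 * y) ^ 2 - 4 * y - 1 := by
    intro u v w hu hv hw
    have t1 : u * (4 * y) ^ 2 ≤ 2 * y * (4 * y) ^ 2 := by gcongr
    have t2 : v * (4 * y) ≤ 2 * y * (4 * y) := by gcongr
    nlinarith [mul_nonneg (sub_nonneg.2 hy) (sq_nonneg y),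
      mul_nonneg (sub_nonneg.2 hy) (by linarith : (0 : ℤ) ≤ y)]
  have y0 : 0 < y := by linarith
  constructor
  · rw [Int.emod_eq_of_lt (by positivity) (hlt _ _ _ (by linarith) (by linarith) (by linarith)),
      add_assoc, add_comm, Int.add_mul_ediv_right _ _ (by positivity),
      Int.ediv_eq_zero_of_lt (by positivity) (by nlinarith), zero_add]
  · rw [Int.emod_eq_of_lt (by positivity) (hlt _ _ _ (by linarith) (by linarith) (by linarith)),
      show (a + b + c) * (4 * y) ^ 2 + (a + b) * (4 * y) + a
        = a + ((a + b + c) * (4 * y) + (a + b)) * (4 * y) by ring,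
      Int.add_mul_emod_self_right, Int.emod_eq_of_lt p2 (by linarith)]
end
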